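/- arXiv:2004.03724 — 3 statements merged into one kernel-verified Lean document; each statement's English description precedes it below -/
import Mathlib

section
/- For every integer q ≥ 3, every s ∈ ℕ and every collection Y_s ∈ 𝕐_s, there exist a function f ∈ Δ^(q)(Y_s) ∩ W^{q−1} and a constant C > 0 (depending only on q and Y_s) such that n · E_n^(q)(f, Y_s) ≥ C for all n ∈ ℕ. -/
noncomputable section

/-- A collection `Y_s ∈ 𝕐_s`: points `y 1 > y 2 > ⋯ > y (2s)` (decreasing in the index),
with the convention `y 0 = y (2s) + 2π`. -/
structure PtsColl (s : ℕ) where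
  y : ℕ → ℝ
  lt : ∀ i : ℕ, 1 ≤ i → i ≤ 2 * s → y i < y (i - 1)
  per : y 0 = y (2 * s) + 2 * Real.pi

/-- `f` is `q`-monotone (for `q ≥ 3`) on `[a,b]`: `f` is continuous on `[a,b]`,
`(q-2)`-times continuously differentiable on `(a,b)`, and `f^{(q-2)}` is convex on `(a,b)`. -/
def QMonotoneOn (q : ℕ) (f : ℝ → ℝ) (a b : ℝ) : Prop :=
  ContinuousOn f (Set.Icc a b) ∧
  ContDiffOn ℝ (q - 2 : ℕ) f (Set.Ioo a b) ∧
  ConvexOn ℝ (Set.Ioo a b) (iteratedDerivWithin (q - 2) f (Set.Ioo a b))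

/-- `f ∈ Δ^(q)(Y_s)`: `f` is continuous, `2π`-periodic, and `(-1)^(i-1) f` is `q`-monotone
on `[y i, y (i-1)]` for each `i = 1, …, 2s`. -/
def DeltaQ (q s : ℕ) (Y : PtsColl s) (f : ℝ → ℝ) : Prop :=
  Continuous f ∧ (∀ x : ℝ, f (x + 2 * Real.pi) = f x) ∧
  ∀ i : ℕ, 1 ≤ i → i ≤ 2 * s →
    QMonotoneOn q (fun x => (-1 : ℝ) ^ (i - 1) * f x) (Y.y i) (Y.y (i - 1))

/-- `T ∈ 𝒯_n`: a real trigonometric polynomial of degree at most `n`. -/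
def IsTrigPoly (n : ℕ) (T : ℝ → ℝ) : Prop :=
  ∃ a b : ℕ → ℝ, ∀ t : ℝ,
    T t = a 0 + ∑ k ∈ Finset.Icc 1 n, (a k * Real.cos (k * t) + b k * Real.sin (k * t))

/-- `f ∈ W^r`: `f` is `2π`-periodic, of class `C^{r-1}`, `f^{(r-1)}` is absolutely continuous
(being the integral of a locally integrable function `g = f^{(r)}`), and `esssup |f^{(r)}| ≤ 2`. -/
def SobolevW (r : ℕ) (f : ℝ → ℝ) : Prop :=
  (∀ x : ℝ, f (x + 2 * Real.pi) = f x) ∧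
  ContDiff ℝ (r - 1 : ℕ) f ∧
  ∃ g : ℝ → ℝ,
    (∀ a b : ℝ, IntervalIntegrable g MeasureTheory.volume a b) ∧
    (∀ᵐ x ∂MeasureTheory.volume, |g x| ≤ 2) ∧
    ∀ x : ℝ, iteratedDeriv (r - 1) f x =
      iteratedDeriv (r - 1) f 0 + ∫ t in (0 : ℝ)..x, g t

/-- `E_n^(q)(f, Y_s)`: the error of the best co-`q`-monotone approximation of `f`
by trigonometric polynomials of degree at most `n` belonging to `Δ^(q)(Y_s)`. -/
def ErrCoQ (q n s : ℕ) (Y : PtsColl s) (f : ℝ → ℝ) : ℝ :=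
  sInf ((fun T => ⨆ x : ℝ, |f x - T x|) '' {T : ℝ → ℝ | IsTrigPoly n T ∧ DeltaQ q s Y T})

open Set Filter Topology Bornology

/-- The trigonometric sum with coefficients `a`, `b`, as an entire function. -/
def complexTrigSum (n : ℕ) (a b : ℕ → ℝ) (z : ℂ) : ℂ :=
  a 0 + ∑ k ∈ Finset.Icc 1 n, (a k * Complex.cos (k * z) + b k * Complex.sin (k * z))

lemma complexTrigSum_ofReal (n : ℕ) (a b : ℕ → ℝ) (x : ℝ) :
    complexTrigSum n a b x =
      ((a 0 + ∑ k ∈ Finset.Icc 1 n, (a k * Real.cos (k * x) + b k * Real.sin (k * x)) : ℝ) : ℂ) := by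
  simp [complexTrigSum]

lemma complexTrigSum_neg (n : ℕ) (a b : ℕ → ℝ) (z : ℂ) :
    complexTrigSum n a b (-z) = complexTrigSum n a (fun k => -b k) z := by
  simp [complexTrigSum]

lemma differentiable_complexTrigSum (n : ℕ) (a b : ℕ → ℝ) :
    Differentiable ℂ (complexTrigSum n a b) := by
  unfold complexTrigSum
  fun_prop

lemma norm_exp_mul_I_le (w : ℂ) : ‖Complex.exp (w * Complex.I)‖ ≤ Real.exp |w.im| := by
  rw [Complex.norm_exp]
  simpa using neg_le_abs w.im

lemma norm_cos_le_exp_abs_im (w : ℂ) : ‖Complex.cos w‖ ≤ Real.exp |w.im| := by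
  have h1 := norm_exp_mul_I_le w
  have h2 := norm_exp_mul_I_le (-w)
  rw [Complex.neg_im, abs_neg] at h2
  rw [Complex.cos, norm_div, Complex.norm_ofNat]
  linarith [norm_add_le (Complex.exp (w * Complex.I)) (Complex.exp (-w * Complex.I))]

lemma norm_sin_le_exp_abs_im (w : ℂ) : ‖Complex.sin w‖ ≤ Real.exp |w.im| := by
  have h1 := norm_exp_mul_I_le w
  have h2 := norm_exp_mul_I_le (-w)
  rw [Complex.neg_im, abs_neg] at h2
  rw [Complex.sin, norm_div, norm_mul, Complex.norm_I, mul_one, Complex.norm_ofNat]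
  linarith [norm_sub_le (Complex.exp (-w * Complex.I)) (Complex.exp (w * Complex.I))]

lemma norm_complexTrigSum_le (n : ℕ) (a b : ℕ → ℝ) (z : ℂ) :
    ‖complexTrigSum n a b z‖ ≤
      (|a 0| + ∑ k ∈ Finset.Icc 1 n, (|a k| + |b k|)) * Real.exp (n * |z.im|) := by
  have hk : ∀ k ∈ Finset.Icc 1 n, Real.exp |((k : ℂ) * z).im| ≤ Real.exp (n * |z.im|) := by
    intro k hk
    have : (k : ℝ) ≤ n := by exact_mod_cast (Finset.mem_Icc.mp hk).2
    have him : ((k : ℂ) * z).im = k * z.im := by simp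
    rw [him, abs_mul, Nat.abs_cast]
    gcongr
  have h1 : 1 ≤ Real.exp (n * |z.im|) := Real.one_le_exp (by positivity)
  rw [add_mul, Finset.sum_mul]
  refine (norm_add_le _ _).trans (add_le_add ?_ ((norm_sum_le _ _).trans
    (Finset.sum_le_sum fun k hkm => ?_)))
  · simpa using le_mul_of_one_le_right (abs_nonneg (a 0)) h1
  · refine (norm_add_le _ _).trans ?_
    rw [norm_mul, norm_mul, add_mul, Complex.norm_real, Complex.norm_real, Real.norm_eq_abs,
      Real.norm_eq_abs]
    gcongr
    · exact (norm_cos_le_exp_abs_im _).trans (hk k hkm)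
    · exact (norm_sin_le_exp_abs_im _).trans (hk k hkm)

/-- A trigonometric sum bounded by `M` on the real axis grows at most like `M * exp (n * |im z|)`. -/
lemma norm_complexTrigSum_le_of_im_nonneg {n : ℕ} {a b : ℕ → ℝ} {M : ℝ}
    (hM : ∀ x : ℝ, ‖complexTrigSum n a b x‖ ≤ M) {w : ℂ} (hw : 0 ≤ w.im) :
    ‖complexTrigSum n a b w‖ ≤ M * Real.exp (n * w.im) := by
  set S := |a 0| + ∑ k ∈ Finset.Icc 1 n, (|a k| + |b k|) with hS
  set g : ℂ → ℂ := fun z => Complex.exp (-(n * z)) * complexTrigSum n a b (Complex.I * z) with hg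
  have hgd : Differentiable ℂ g := by
    have := differentiable_complexTrigSum n a b
    fun_prop
  have hnorm : ∀ z : ℂ, ‖g z‖ =
      Real.exp (-(n * z.re)) * ‖complexTrigSum n a b (Complex.I * z)‖ := by
    intro z
    simp [hg, Complex.norm_exp]
  have hgS : ∀ z : ℂ, 0 ≤ z.re → ‖g z‖ ≤ S := by
    intro z hz
    have h := norm_complexTrigSum_le n a b (Complex.I * z)
    have him : (Complex.I * z).im = z.re := by simp
    rw [him, abs_of_nonneg hz] at h
    calc ‖g z‖ = Real.exp (-(n * z.re)) * ‖complexTrigSum n a b (Complex.I * z)‖ := hnorm z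
      _ ≤ Real.exp (-(n * z.re)) * (S * Real.exp (n * z.re)) := by gcongr
      _ = S * (Real.exp (-(n * z.re)) * Real.exp (n * z.re)) := by ring
      _ = S := by rw [← Real.exp_add]; simp
  have hgM : ∀ z : ℂ, 0 ≤ z.re → ‖g z‖ ≤ M := by
    intro z hz
    refine PhragmenLindelof.right_half_plane_of_bounded_on_real hgd.diffContOnCl
      ⟨0, by norm_num, 0, ?_⟩ ?_ ?_ hz
    · refine Asymptotics.IsBigO.of_bound S (eventually_inf_principal.mpr (Eventually.of_forall ?_))
      intro z hz
      simpa using hgS z (le_of_lt hz)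
    · refine ⟨S, eventually_map.mpr ?_⟩
      filter_upwards [eventually_ge_atTop 0] with x hx
      exact hgS x (by simpa using hx)
    · intro x
      rw [hnorm]
      have hx : Complex.I * (x * Complex.I) = ((-x : ℝ) : ℂ) := by
        rw [mul_left_comm, Complex.I_mul_I]; simp
      rw [hx]
      simpa using hM (-x)
  have h := hgM (-(Complex.I * w)) (by simpa using hw)
  rw [hnorm] at h
  have hIw : Complex.I * -(Complex.I * w) = w := by
    rw [mul_neg, ← mul_assoc, Complex.I_mul_I]; simp
  have hre : (-(Complex.I * w)).re = w.im := by simp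
  rw [hIw, hre, Real.exp_neg, inv_mul_le_iff₀ (Real.exp_pos _)] at h
  linarith

lemma norm_complexTrigSum_le_of_bounded {n : ℕ} {a b : ℕ → ℝ} {M : ℝ}
    (hM : ∀ x : ℝ, ‖complexTrigSum n a b x‖ ≤ M) (w : ℂ) :
    ‖complexTrigSum n a b w‖ ≤ M * Real.exp (n * |w.im|) := by
  rcases le_total 0 w.im with hw | hw
  · rw [abs_of_nonneg hw]
    exact norm_complexTrigSum_le_of_im_nonneg hM hw
  · have h : ∀ x : ℝ, ‖complexTrigSum n a (fun k => -b k) x‖ ≤ M := by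
      intro x
      rw [← complexTrigSum_neg]
      simpa using hM (-x)
    have := norm_complexTrigSum_le_of_im_nonneg h (w := -w) (by simpa using hw)
    rwa [← complexTrigSum_neg, neg_neg, Complex.neg_im, ← abs_of_nonpos hw] at this

/-- Bernstein's inequality for trigonometric polynomials, up to the constant. -/
lemma IsTrigPoly.abs_deriv_le {n : ℕ} (hn : 1 ≤ n) {T : ℝ → ℝ} (hT : IsTrigPoly n T) {M : ℝ}
    (hM : ∀ x, |T x| ≤ M) (x : ℝ) : |deriv T x| ≤ 3 * n * M := by
  obtain ⟨a, b, hab⟩ := hT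
  have hn0 : (0 : ℝ) < n := by exact_mod_cast hn
  have hM0 : 0 ≤ M := (abs_nonneg _).trans (hM 0)
  have hTc : ∀ x : ℝ, complexTrigSum n a b x = (T x : ℂ) := fun x => by
    rw [complexTrigSum_ofReal, hab]
  have hbd : ∀ x : ℝ, ‖complexTrigSum n a b x‖ ≤ M := fun x => by
    rw [hTc, Complex.norm_real]; exact hM x
  have hd := differentiable_complexTrigSum n a b
  have hT' : T = fun x : ℝ => (complexTrigSum n a b x).re := by
    funext x; rw [hTc, Complex.ofReal_re]
  have hder : HasDerivAt T (deriv (complexTrigSum n a b) x).re x := by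
    rw [hT']
    exact (hd x).hasDerivAt.real_of_complex
  rw [hder.deriv]
  refine (Complex.abs_re_le_norm _).trans ?_
  have hc := Complex.norm_deriv_le_of_forall_mem_sphere_norm_le (c := (x : ℂ)) (R := 1 / n)
    (C := M * Real.exp 1) (f := complexTrigSum n a b) (by positivity) hd.diffContOnCl ?_
  · refine hc.trans ?_
    rw [div_div_eq_mul_div, div_one]
    nlinarith [Real.exp_one_lt_d9, mul_nonneg hM0 hn0.le]
  · intro z hz
    refine (norm_complexTrigSum_le_of_bounded hbd z).trans ?_
    have him : |z.im| ≤ 1 / n := by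
      have h := Complex.abs_im_le_norm (z - x)
      rw [mem_sphere_iff_norm.mp hz] at h
      simpa using h
    have : (n : ℝ) * |z.im| ≤ 1 := by
      calc (n : ℝ) * |z.im| ≤ n * (1 / n) := by gcongr
        _ = 1 := by field_simp
    gcongr

lemma IsTrigPoly.contDiff {n : ℕ} {T : ℝ → ℝ} (hT : IsTrigPoly n T) {m : WithTop ℕ∞} :
    ContDiff ℝ m T := by
  obtain ⟨a, b, hab⟩ := hT
  rw [funext hab]
  fun_prop

lemma IsTrigPoly.deriv {n : ℕ} {T : ℝ → ℝ} (hT : IsTrigPoly n T) : IsTrigPoly n (deriv T) := by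
  obtain ⟨a, b, hab⟩ := hT
  refine ⟨fun k => k * b k, fun k => -(k * a k), fun t => ?_⟩
  rw [funext hab]
  have : HasDerivAt (fun t => a 0 + ∑ k ∈ Finset.Icc 1 n,
      (a k * Real.cos (k * t) + b k * Real.sin (k * t)))
      (∑ k ∈ Finset.Icc 1 n, (a k * (-Real.sin (k * t) * (k * 1)) +
        b k * (Real.cos (k * t) * (k * 1)))) t := by
    refine (HasDerivAt.fun_sum fun k _ => ?_).const_add _
    have hk : HasDerivAt (fun t : ℝ => (k : ℝ) * t) (k * 1) t := (hasDerivAt_id t).const_mul _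
    exact (hk.cos.const_mul _).add (hk.sin.const_mul _)
  rw [this.deriv]
  simp only [Nat.cast_zero, zero_mul, zero_add]
  refine Finset.sum_congr rfl fun k _ => ?_
  ring

lemma IsTrigPoly.iteratedDeriv {n : ℕ} {T : ℝ → ℝ} (hT : IsTrigPoly n T) (m : ℕ) :
    IsTrigPoly n (iteratedDeriv m T) := by
  induction m with
  | zero => simpa using hT
  | succ m ih => rw [iteratedDeriv_succ]; exact ih.deriv

lemma IsTrigPoly.periodic {n : ℕ} {T : ℝ → ℝ} (hT : IsTrigPoly n T) :
    Function.Periodic T (2 * Real.pi) := by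
  obtain ⟨a, b, hab⟩ := hT
  intro x
  rw [hab, hab]
  congr 1
  refine Finset.sum_congr rfl fun k _ => ?_
  rw [mul_add, Real.cos_add_nat_mul_two_pi, Real.sin_add_nat_mul_two_pi]

lemma isTrigPoly_zero (n : ℕ) : IsTrigPoly n (fun _ => 0) :=
  ⟨fun _ => 0, fun _ => 0, by simp⟩

lemma ConvexOn.Icc_of_Ioo {f : ℝ → ℝ} {a b : ℝ} (hab : a < b) (hf : Continuous f)
    (hc : ConvexOn ℝ (Ioo a b) f) : ConvexOn ℝ (Icc a b) f := by
  refine ⟨convex_Icc a b, fun x hx y hy p r hp hr hpr => ?_⟩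
  set c := (a + b) / 2 with hcdef
  have hmem : ∀ z ∈ Icc a b, ∀ t ∈ Ioo (0 : ℝ) 1, (1 - t) * z + t * c ∈ Ioo a b := by
    rintro z ⟨hz1, hz2⟩ t ⟨ht0, ht1⟩
    constructor <;> nlinarith
  have hlim : ∀ z, Tendsto (fun t : ℝ => f ((1 - t) * z + t * c)) (𝓝[>] 0) (𝓝 (f z)) := by
    intro z
    refine Tendsto.mono_left ?_ nhdsWithin_le_nhds
    exact Continuous.tendsto' (by fun_prop) _ _ (by simp)
  refine le_of_tendsto_of_tendsto (hlim (p • x + r • y))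
    (((hlim x).const_mul p).add ((hlim y).const_mul r)) ?_
  filter_upwards [Ioo_mem_nhdsGT (zero_lt_one (α := ℝ))] with t ht
  have h := hc.2 (hmem x hx t ht) (hmem y hy t ht) hp hr hpr
  simp only [smul_eq_mul] at h ⊢
  convert h using 2
  linear_combination -(t * c) * hpr

/-- A function bounded by `ε` has a derivative of order `m` of size `O(ε)` somewhere
in each interval. -/
lemma exists_abs_iteratedDeriv_le (m : ℕ) : ∀ c d : ℝ, c < d → ∃ K : ℝ, 0 < K ∧
    ∀ (φ : ℝ → ℝ) (ε : ℝ), ContDiff ℝ m φ → (∀ x, |φ x| ≤ ε) →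
      ∃ ξ ∈ Icc c d, |iteratedDeriv m φ ξ| ≤ K * ε := by
  induction m with
  | zero =>
    intro c d hcd
    exact ⟨1, one_pos, fun φ ε _ h => ⟨c, ⟨le_rfl, hcd.le⟩, by simpa using h c⟩⟩
  | succ m ih =>
    intro c d hcd
    obtain ⟨K₁, hK₁, h₁⟩ := ih c (c + (d - c) / 3) (by linarith)
    obtain ⟨K₂, hK₂, h₂⟩ := ih (d - (d - c) / 3) d (by linarith)
    have hℓ : 0 < (d - c) / 3 := by linarith
    refine ⟨(K₁ + K₂) / ((d - c) / 3), by positivity, fun φ ε hφ hε => ?_⟩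
    have hφm : ContDiff ℝ m φ := hφ.of_le (by exact_mod_cast Nat.le_succ m)
    obtain ⟨ξ₁, ⟨h₁c, h₁d⟩, hξ₁⟩ := h₁ φ ε hφm hε
    obtain ⟨ξ₂, ⟨h₂c, h₂d⟩, hξ₂⟩ := h₂ φ ε hφm hε
    have hlt : ξ₁ < ξ₂ := by linarith
    have hdiff : Differentiable ℝ (iteratedDeriv m φ) :=
      hφ.differentiable_iteratedDeriv m (by exact_mod_cast Nat.lt_succ_self m)
    obtain ⟨ξ, ⟨hξc, hξd⟩, hξ⟩ := exists_deriv_eq_slope (iteratedDeriv m φ) hlt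
      hdiff.continuous.continuousOn hdiff.differentiableOn
    refine ⟨ξ, ⟨by linarith, by linarith⟩, ?_⟩
    have hε0 : 0 ≤ ε := (abs_nonneg _).trans (hε 0)
    rw [iteratedDeriv_succ, hξ, abs_div, abs_of_pos (sub_pos.mpr hlt), div_mul_eq_mul_div]
    apply div_le_div₀ (by positivity) _ hℓ (by linarith)
    calc |iteratedDeriv m φ ξ₂ - iteratedDeriv m φ ξ₁|
        ≤ |iteratedDeriv m φ ξ₂| + |iteratedDeriv m φ ξ₁| := abs_sub _ _
      _ ≤ (K₁ + K₂) * ε := by linarith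

/-- If two points of `[c, d]` at distance at least `δ` carry small values of a convex function,
the function is not very negative outside the interval they bound. -/
lemma ConvexOn.neg_le_of_abs_le {h : ℝ → ℝ} {c d : ℝ} (hc : ConvexOn ℝ (Icc c d) h)
    {x p r δ E : ℝ} (hx : x ∈ Icc c d) (hr : r ∈ Icc c d) (hδ : 0 < δ)
    (hpr : δ ≤ |r - p|) (hxpr : (x < p ∧ p < r) ∨ (r < p ∧ p < x))
    (hhp : |h p| ≤ E) (hhr : |h r| ≤ E) : -((2 * (d - c) / δ) * E) ≤ h x := by
  have hE : 0 ≤ E := (abs_nonneg _).trans hhp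
  obtain ⟨hp1, hp2⟩ := abs_le.mp hhp
  obtain ⟨hr1, hr2⟩ := abs_le.mp hhr
  obtain ⟨hxc, hxd⟩ := hx
  obtain ⟨hrc, hrd⟩ := hr
  have key : -(2 * (d - c) * E) ≤ h x * |r - p| := by
    rcases hxpr with ⟨hxp, hpr'⟩ | ⟨hrp, hpx⟩
    · have hs := hc.slope_mono_adjacent ⟨hxc, hxd⟩ ⟨hrc, hrd⟩ hxp hpr'
      rw [div_le_div_iff₀ (by linarith) (by linarith)] at hs
      rw [abs_of_pos (by linarith)]
      have h1 : (p - x) * (h r - h p) ≤ (p - x) * (2 * E) :=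
        mul_le_mul_of_nonneg_left (by linarith) (by linarith)
      have h2 : (r - p) * (-E) ≤ (r - p) * h p :=
        mul_le_mul_of_nonneg_left hp1 (by linarith)
      have h3 : (2 * (p - x) + (r - p)) * E ≤ (2 * (d - c)) * E :=
        mul_le_mul_of_nonneg_right (by linarith) hE
      linarith
    · have hs := hc.slope_mono_adjacent ⟨hrc, hrd⟩ ⟨hxc, hxd⟩ hrp hpx
      rw [div_le_div_iff₀ (by linarith) (by linarith)] at hs
      rw [abs_of_neg (by linarith)]
      have h1 : (x - p) * (h r - h p) ≤ (x - p) * (2 * E) :=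
        mul_le_mul_of_nonneg_left (by linarith) (by linarith)
      have h2 : (p - r) * (-E) ≤ (p - r) * h p :=
        mul_le_mul_of_nonneg_left hp1 (by linarith)
      have h3 : (2 * (x - p) + (p - r)) * E ≤ (2 * (d - c)) * E :=
        mul_le_mul_of_nonneg_right (by linarith) hE
      linarith
  rcases le_total 0 (h x) with h0 | h0
  · have : 0 ≤ (2 * (d - c) / δ) * E := by
      have : c ≤ d := by linarith
      have : 0 ≤ d - c := by linarith
      positivity
    linarith
  · have h4 : h x * |r - p| ≤ h x * δ := mul_le_mul_of_nonpos_left hpr h0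
    rw [div_mul_eq_mul_div, ← neg_div, div_le_iff₀ hδ]
    linarith

lemma exists_neg_le_of_convexOn_iteratedDeriv (m : ℕ) (c d : ℝ) (hcd : c < d) :
    ∃ K : ℝ, 0 < K ∧ ∀ (φ : ℝ → ℝ) (ε : ℝ), ContDiff ℝ m φ → (∀ x, |φ x| ≤ ε) →
      ConvexOn ℝ (Icc c d) (iteratedDeriv m φ) →
        ∀ x ∈ Icc c d, -(K * ε) ≤ iteratedDeriv m φ x := by
  set δ := (d - c) / 8 with hδ
  have hδ0 : 0 < δ := by linarith
  obtain ⟨K₁, hK₁, h₁⟩ := exists_abs_iteratedDeriv_le m c (c + δ) (by linarith)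
  obtain ⟨K₂, hK₂, h₂⟩ := exists_abs_iteratedDeriv_le m (c + 2 * δ) (c + 3 * δ) (by linarith)
  obtain ⟨K₃, hK₃, h₃⟩ := exists_abs_iteratedDeriv_le m (d - 3 * δ) (d - 2 * δ) (by linarith)
  obtain ⟨K₄, hK₄, h₄⟩ := exists_abs_iteratedDeriv_le m (d - δ) d (by linarith)
  have hdc : 0 < d - c := by linarith
  refine ⟨2 * (d - c) / δ * (K₁ + K₂ + K₃ + K₄), by positivity, fun φ ε hφ hε hconv x hx => ?_⟩
  have hε0 : 0 ≤ ε := (abs_nonneg _).trans (hε 0)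
  obtain ⟨ξ₁, ⟨h₁c, h₁d⟩, hξ₁⟩ := h₁ φ ε hφ hε
  obtain ⟨ξ₂, ⟨h₂c, h₂d⟩, hξ₂⟩ := h₂ φ ε hφ hε
  obtain ⟨ξ₃, ⟨h₃c, h₃d⟩, hξ₃⟩ := h₃ φ ε hφ hε
  obtain ⟨ξ₄, ⟨h₄c, h₄d⟩, hξ₄⟩ := h₄ φ ε hφ hε
  have e₁ := mul_nonneg hK₁.le hε0
  have e₂ := mul_nonneg hK₂.le hε0
  have e₃ := mul_nonneg hK₃.le hε0
  have e₄ := mul_nonneg hK₄.le hε0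
  rw [mul_assoc]
  rcases le_total x ((c + d) / 2) with hxm | hxm
  · refine hconv.neg_le_of_abs_le hx (p := ξ₃) (r := ξ₄)
      ⟨by linarith, by linarith⟩ hδ0 ?_ (Or.inl ⟨by linarith, by linarith⟩)
      (by linarith) (by linarith)
    exact le_trans (by linarith) (le_abs_self _)
  · refine hconv.neg_le_of_abs_le hx (p := ξ₂) (r := ξ₁)
      ⟨by linarith, by linarith⟩ hδ0 ?_ (Or.inr ⟨by linarith, by linarith⟩)
      (by linarith) (by linarith)
    exact le_trans (by linarith) (neg_le_abs _)

lemma Function.Periodic.iteratedDeriv {f : ℝ → ℝ} {p : ℝ} (hf : Function.Periodic f p) (m : ℕ) :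
    Function.Periodic (iteratedDeriv m f) p := by
  intro x
  have h : (fun z => f (z + p)) = f := funext hf
  have := congrFun (iteratedDeriv_comp_add_const m f p) x
  rw [h] at this
  exact this.symm

namespace PtsColl

lemma y_le {s : ℕ} (Y : PtsColl s) {i j : ℕ} (hij : i ≤ j) (hj : j ≤ 2 * s) : Y.y j ≤ Y.y i := by
  induction j, hij using Nat.le_induction with
  | base => exact le_rfl
  | succ j _ ih => exact (Y.lt (j + 1) (by omega) hj).le.trans (ih (by omega))

lemma y_lt {s : ℕ} (Y : PtsColl s) {i j : ℕ} (hij : i < j) (hj : j ≤ 2 * s) : Y.y j < Y.y i :=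
  (Y.lt j (by omega) hj).trans_le (Y.y_le (by omega) (by omega))

lemma exists_mem_Icc {s : ℕ} (Y : PtsColl s) {x : ℝ} {j : ℕ} (hj1 : 1 ≤ j) (hj : j ≤ 2 * s)
    (hx : x ∈ Icc (Y.y j) (Y.y 0)) :
    ∃ i, 1 ≤ i ∧ i ≤ 2 * s ∧ x ∈ Icc (Y.y i) (Y.y (i - 1)) := by
  induction j, hj1 using Nat.le_induction with
  | base => exact ⟨1, le_rfl, hj, hx⟩
  | succ j hj1 ih =>
    rcases le_total (Y.y j) x with h | h
    · exact ih (by omega) ⟨h, hx.2⟩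
    · exact ⟨j + 1, by omega, hj, hx.1, h⟩

end PtsColl

/-- Let `φ` be periodic with `φ^(m)` alternately convex and concave between the points of `Y`.
Then the sup norm of `φ` controls that of `φ^(m)`. -/
lemma exists_abs_iteratedDeriv_le_of_alternating (m : ℕ) {s : ℕ} (hs : 1 ≤ s) (Y : PtsColl s) :
    ∃ K : ℝ, 0 < K ∧ ∀ (φ : ℝ → ℝ) (ε : ℝ), ContDiff ℝ m φ →
      Function.Periodic φ (2 * Real.pi) → (∀ x, |φ x| ≤ ε) →
      (∀ i, 1 ≤ i → i ≤ 2 * s → ConvexOn ℝ (Icc (Y.y i) (Y.y (i - 1)))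
        (fun x => (-1 : ℝ) ^ (i - 1) * iteratedDeriv m φ x)) →
      ∀ x, |iteratedDeriv m φ x| ≤ K * ε := by
  have hex : ∀ i, ∃ K : ℝ, 0 < K ∧ (1 ≤ i → i ≤ 2 * s → ∀ (φ : ℝ → ℝ) (ε : ℝ), ContDiff ℝ m φ →
      (∀ x, |φ x| ≤ ε) → ConvexOn ℝ (Icc (Y.y i) (Y.y (i - 1))) (iteratedDeriv m φ) →
        ∀ x ∈ Icc (Y.y i) (Y.y (i - 1)), -(K * ε) ≤ iteratedDeriv m φ x) := by
    intro i
    by_cases hi : 1 ≤ i ∧ i ≤ 2 * s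
    · obtain ⟨K, hK, h⟩ := exists_neg_le_of_convexOn_iteratedDeriv m _ _ (Y.lt i hi.1 hi.2)
      exact ⟨K, hK, fun _ _ => h⟩
    · exact ⟨1, one_pos, fun h1 h2 => absurd ⟨h1, h2⟩ hi⟩
  choose K hK0 hK using hex
  refine ⟨∑ i ∈ Finset.Icc 1 (2 * s), K i, Finset.sum_pos (fun i _ => hK0 i)
    ⟨1, Finset.mem_Icc.mpr ⟨le_rfl, by omega⟩⟩, fun φ ε hφ hper hε hconv => ?_⟩
  have hε0 : 0 ≤ ε := (abs_nonneg _).trans (hε 0)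
  set E := (∑ i ∈ Finset.Icc 1 (2 * s), K i) * ε with hE
  set h := iteratedDeriv m φ with hh
  have hperh : Function.Periodic h (2 * Real.pi) := hper.iteratedDeriv m
  have hlow : ∀ i, 1 ≤ i → i ≤ 2 * s → ∀ x ∈ Icc (Y.y i) (Y.y (i - 1)),
      -E ≤ (-1 : ℝ) ^ (i - 1) * h x := by
    intro i hi1 hi2 x hx
    have hfun : iteratedDeriv m (fun x => (-1 : ℝ) ^ (i - 1) * φ x) =
        fun x => (-1 : ℝ) ^ (i - 1) * h x := by
      funext x
      rw [iteratedDeriv_const_mul_field]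
    have := hK i hi1 hi2 (fun x => (-1 : ℝ) ^ (i - 1) * φ x) ε (by fun_prop)
      (fun x => by simpa [abs_mul] using hε x) (by rw [hfun]; exact hconv i hi1 hi2) x hx
    rw [hfun] at this
    have hle : K i * ε ≤ E := mul_le_mul_of_nonneg_right
      (Finset.single_le_sum (f := K) (fun j _ => (hK0 j).le) (Finset.mem_Icc.mpr ⟨hi1, hi2⟩)) hε0
    linarith
  have hright : ∀ i, 1 ≤ i → i ≤ 2 * s → -E ≤ (-1 : ℝ) ^ (i - 1) * h (Y.y (i - 1)) :=
    fun i hi1 hi2 => hlow i hi1 hi2 _ ⟨(Y.lt i hi1 hi2).le, le_rfl⟩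
  have hleft : ∀ i, 1 ≤ i → i ≤ 2 * s → -E ≤ (-1 : ℝ) ^ (i - 1) * h (Y.y i) :=
    fun i hi1 hi2 => hlow i hi1 hi2 _ ⟨le_rfl, (Y.lt i hi1 hi2).le⟩
  have hends : h (Y.y 0) = h (Y.y (2 * s)) := by rw [Y.per]; exact hperh _
  have hnode0 : |h (Y.y 0)| ≤ E := by
    have h1 := hright 1 le_rfl (by omega)
    have h2 := hleft (2 * s) (by omega) le_rfl
    rw [Odd.neg_one_pow ⟨s - 1, by omega⟩] at h2
    rw [← hends] at h2
    simp only [Nat.sub_self, pow_zero, one_mul] at h1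
    exact abs_le.mpr ⟨h1, by linarith⟩
  have hnode : ∀ j, j ≤ 2 * s → |h (Y.y j)| ≤ E := by
    intro j hj
    rcases Nat.eq_zero_or_pos j with rfl | hj0
    · exact hnode0
    rcases eq_or_lt_of_le hj with rfl | hjlt
    · rw [← hends]; exact hnode0
    have h1 := hleft j hj0 hj
    have h2 := hright (j + 1) (by omega) (by omega)
    have hp : (-1 : ℝ) ^ j = -(-1 : ℝ) ^ (j - 1) := by
      conv_lhs => rw [← Nat.sub_add_cancel hj0]
      rw [pow_succ]; ring
    rw [Nat.add_sub_cancel, hp] at h2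
    have : |(-1 : ℝ) ^ (j - 1) * h (Y.y j)| ≤ E := abs_le.mpr ⟨h1, by linarith⟩
    simpa [abs_mul] using this
  have hup : ∀ i, 1 ≤ i → i ≤ 2 * s → ∀ x ∈ Icc (Y.y i) (Y.y (i - 1)), |h x| ≤ E := by
    intro i hi1 hi2 x hx
    have hle := (Y.lt i hi1 hi2).le
    have hsgn : ∀ z, |h z| ≤ E → (-1 : ℝ) ^ (i - 1) * h z ≤ E := fun z hz =>
      (le_abs_self _).trans (by simpa [abs_mul] using hz)
    have h1 := (hconv i hi1 hi2).le_max_of_mem_Icc ⟨le_rfl, hle⟩ ⟨hle, le_rfl⟩ hx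
    have h2 := h1.trans (max_le (hsgn _ (hnode i hi2)) (hsgn _ (hnode (i - 1) (by omega))))
    have : |(-1 : ℝ) ^ (i - 1) * h x| ≤ E := abs_le.mpr ⟨hlow i hi1 hi2 x hx, h2⟩
    simpa [abs_mul] using this
  intro x
  obtain ⟨z, hz, hxz⟩ := hperh.exists_mem_Ico Real.two_pi_pos x (Y.y (2 * s))
  rw [← Y.per] at hz
  obtain ⟨i, hi1, hi2, hi⟩ := Y.exists_mem_Icc (by omega) le_rfl ⟨hz.1, hz.2.le⟩
  rw [hxz]
  exact hup i hi1 hi2 z hi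

/-- A continuous periodic function of mean zero has a periodic primitive of mean zero. -/
lemma exists_periodic_primitive {g : ℝ → ℝ} {p : ℝ} (hp : 0 < p) (hg : Continuous g)
    (hper : Function.Periodic g p) (hmean : ∫ x in (0 : ℝ)..p, g x = 0) :
    ∃ G : ℝ → ℝ, (∀ x, HasDerivAt G (g x) x) ∧ Function.Periodic G p ∧
      ∫ x in (0 : ℝ)..p, G x = 0 := by
  set H : ℝ → ℝ := fun x => ∫ t in (0 : ℝ)..x, g t with hH
  have hHd : ∀ x, HasDerivAt H (g x) x := fun x =>
    intervalIntegral.integral_hasDerivAt_right (hg.intervalIntegrable _ _)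
      (hg.stronglyMeasurableAtFilter _ _) hg.continuousAt
  have hHc : Continuous H := continuous_iff_continuousAt.mpr fun x => (hHd x).continuousAt
  set c := (∫ x in (0 : ℝ)..p, H x) / p with hc
  refine ⟨fun x => H x - c, fun x => (hHd x).sub_const c, fun x => ?_, ?_⟩
  · have h1 : H (x + p) - H x = ∫ t in x..x + p, g t :=
      intervalIntegral.integral_interval_sub_left (hg.intervalIntegrable _ _)
        (hg.intervalIntegrable _ _)
    rw [hper.intervalIntegral_add_eq x 0, zero_add, hmean] at h1
    simp only
    linarith
  · rw [intervalIntegral.integral_sub (hHc.intervalIntegrable _ _) (by simp)]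
    simp only [intervalIntegral.integral_const, smul_eq_mul, sub_zero, hc]
    field_simp
    ring

lemma exists_periodic_iteratedDeriv_eq {p : ℝ} (hp : 0 < p) (m : ℕ) :
    ∀ {g : ℝ → ℝ}, Continuous g → Function.Periodic g p → ∫ x in (0 : ℝ)..p, g x = 0 →
      ∃ f : ℝ → ℝ, ContDiff ℝ m f ∧ Function.Periodic f p ∧ iteratedDeriv m f = g := by
  induction m with
  | zero =>
    intro g hg hper _
    exact ⟨g, contDiff_zero.mpr hg, hper, iteratedDeriv_zero⟩
  | succ m ih =>
    intro g hg hper hmean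
    obtain ⟨G, hGd, hGper, hGmean⟩ := exists_periodic_primitive hp hg hper hmean
    have hGc : Continuous G := continuous_iff_continuousAt.mpr fun x => (hGd x).continuousAt
    obtain ⟨f, hf, hfper, hfG⟩ := ih hGc hGper hGmean
    have hderiv : deriv G = g := funext fun x => (hGd x).deriv
    refine ⟨f, ?_, hfper, by rw [iteratedDeriv_succ, hfG, hderiv]⟩
    rw [contDiff_nat_iff_iteratedDeriv]
    refine ⟨fun k hk => ?_, fun k hk => ?_⟩
    · rcases Nat.lt_or_ge m k with h | h
      · obtain rfl : k = m + 1 := by omega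
        rw [iteratedDeriv_succ, hfG, hderiv]
        exact hg
      · exact hf.continuous_iteratedDeriv k (by exact_mod_cast h)
    · rcases Nat.lt_or_ge k m with h | h
      · exact hf.differentiable_iteratedDeriv k (by exact_mod_cast h)
      · obtain rfl : k = m := by omega
        rw [hfG]
        exact fun x => (hGd x).differentiableAt

/-- The `p`-periodic step function equal to `u` on `[a, a + L)` and to `v` on `[a + L, a + p)`. -/
def periodicStep (p a L u v x : ℝ) : ℝ := if Int.fract ((x - a) / p) < L / p then u else v

lemma periodicStep_periodic {p : ℝ} (hp : 0 < p) (a L u v : ℝ) :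
    Function.Periodic (periodicStep p a L u v) p := by
  intro x
  have : (x + p - a) / p = (x - a) / p + 1 := by field_simp; ring
  simp [periodicStep, this]

lemma periodicStep_eq_left {p a L u v x : ℝ} (hp : 0 < p) (hLp : L ≤ p) (h1 : a ≤ x)
    (h2 : x < a + L) : periodicStep p a L u v x = u := by
  have hf : Int.fract ((x - a) / p) = (x - a) / p := Int.fract_eq_self.mpr
    ⟨div_nonneg (by linarith) hp.le, (div_lt_one hp).mpr (by linarith)⟩
  rw [periodicStep, hf, if_pos (div_lt_div_of_pos_right (by linarith) hp)]

lemma periodicStep_eq_right {p a L u v x : ℝ} (hp : 0 < p) (hL : 0 ≤ L) (h1 : a + L ≤ x)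
    (h2 : x < a + p) : periodicStep p a L u v x = v := by
  have hf : Int.fract ((x - a) / p) = (x - a) / p := Int.fract_eq_self.mpr
    ⟨div_nonneg (by linarith) hp.le, (div_lt_one hp).mpr (by linarith)⟩
  rw [periodicStep, hf, if_neg (not_lt.mpr (div_le_div_of_nonneg_right (by linarith) hp.le))]

lemma abs_periodicStep_le {p a L u v C : ℝ} (hu : |u| ≤ C) (hv : |v| ≤ C) (x : ℝ) :
    |periodicStep p a L u v x| ≤ C := by
  unfold periodicStep
  split_ifs <;> assumption

lemma intervalIntegrable_periodicStep (p a L u v c d : ℝ) :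
    IntervalIntegrable (periodicStep p a L u v) MeasureTheory.volume c d := by
  have hm : Measurable (periodicStep p a L u v) :=
    Measurable.ite (measurableSet_lt (by fun_prop) (by fun_prop))
      measurable_const measurable_const
  refine (intervalIntegrable_const (c := max |u| |v|)).mono_fun' hm.aestronglyMeasurable
    (Eventually.of_forall fun x => ?_)
  exact abs_periodicStep_le (le_max_left _ _) (le_max_right _ _) x

lemma integral_eq_of_forall_Ioo {g : ℝ → ℝ} {c d v : ℝ} (hcd : c ≤ d)
    (h : ∀ x ∈ Ioo c d, g x = v) : ∫ x in c..d, g x = (d - c) * v := by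
  rw [intervalIntegral.integral_of_le hcd, MeasureTheory.integral_Ioc_eq_integral_Ioo,
    MeasureTheory.setIntegral_congr_fun measurableSet_Ioo h]
  simp [hcd]

/-- A periodic, mean-zero, piecewise linear function with corners only at the last two points of
`Y` and their translates; the slope jumps by `2` at `Y.y 1`. -/
lemma exists_piecewise_linear {s : ℕ} (hs : 1 ≤ s) (Y : PtsColl s) :
    ∃ (F g : ℝ → ℝ) (A : ℝ), Continuous F ∧ Function.Periodic F (2 * Real.pi) ∧
      ∫ x in (0 : ℝ)..(2 * Real.pi), F x = 0 ∧
      (∀ c d, IntervalIntegrable g MeasureTheory.volume c d) ∧ (∀ x, |g x| ≤ 2) ∧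
      (∀ c d, F d - F c = ∫ t in c..d, g t) ∧
      (∀ c d, Y.y 2 ≤ c → c ≤ d → d ≤ Y.y 1 → F d - F c = (d - c) * -A) ∧
      (∀ c d, Y.y 1 ≤ c → c ≤ d → d ≤ Y.y 0 → F d - F c = (d - c) * (2 - A)) ∧
      (∀ c d, Y.y (2 * s) ≤ c → c ≤ d → d ≤ Y.y 2 → F d - F c = (d - c) * (2 - A)) := by
  have hπ := Real.pi_pos
  have h2π := Real.two_pi_pos
  have h21 : Y.y 2 < Y.y 1 := Y.lt 2 (by omega) (by omega)
  have h10 : Y.y 1 < Y.y 0 := Y.lt 1 le_rfl (by omega)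
  have h2s : Y.y (2 * s) ≤ Y.y 2 := Y.y_le (by omega) le_rfl
  have hper := Y.per
  set L := Y.y 1 - Y.y 2 with hL
  set A := 2 - L / Real.pi with hA
  have hL0 : 0 < L := by linarith
  have hL2 : L < 2 * Real.pi := by linarith
  have hLπ0 : 0 < L / Real.pi := by positivity
  have hLπ2 : L / Real.pi < 2 := by rw [div_lt_iff₀ hπ]; linarith
  set g := periodicStep (2 * Real.pi) (Y.y 2) L (-A) (2 - A) with hg
  have hgper : Function.Periodic g (2 * Real.pi) := periodicStep_periodic h2π _ _ _ _
  have hgi : ∀ c d, IntervalIntegrable g MeasureTheory.volume c d :=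
    intervalIntegrable_periodicStep _ _ _ _ _
  have hleft : ∀ c d, Y.y 2 ≤ c → c ≤ d → d ≤ Y.y 1 → ∫ t in c..d, g t = (d - c) * -A :=
    fun c d hc hcd hd => integral_eq_of_forall_Ioo hcd fun x hx =>
      periodicStep_eq_left h2π hL2.le (by linarith [hx.1]) (by linarith [hx.2])
  have hright : ∀ c d, Y.y 1 ≤ c → c ≤ d → d ≤ Y.y 2 + 2 * Real.pi →
      ∫ t in c..d, g t = (d - c) * (2 - A) :=
    fun c d hc hcd hd => integral_eq_of_forall_Ioo hcd fun x hx =>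
      periodicStep_eq_right h2π hL0.le (by linarith [hx.1]) (by linarith [hx.2])
  have hright' : ∀ c d, Y.y (2 * s) ≤ c → c ≤ d → d ≤ Y.y 2 →
      ∫ t in c..d, g t = (d - c) * (2 - A) :=
    fun c d hc hcd hd => integral_eq_of_forall_Ioo hcd fun x hx => by
      rw [← hgper x]
      exact periodicStep_eq_right h2π hL0.le (by linarith [hx.1]) (by linarith [hx.2])
  have hgmean : ∀ x, ∫ t in x..x + 2 * Real.pi, g t = 0 := by
    intro x
    rw [hgper.intervalIntegral_add_eq x (Y.y 2),
      ← intervalIntegral.integral_add_adjacent_intervals (hgi _ (Y.y 1)) (hgi _ _),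
      hleft _ _ le_rfl h21.le le_rfl, hright _ _ le_rfl (by linarith) le_rfl]
    have : L / Real.pi * Real.pi = L := by field_simp
    linear_combination 2 * this
  set H : ℝ → ℝ := fun x => ∫ t in (0 : ℝ)..x, g t with hH
  have hHc : Continuous H := intervalIntegral.continuous_primitive hgi 0
  have hHsub : ∀ c d, H d - H c = ∫ t in c..d, g t := fun c d =>
    intervalIntegral.integral_interval_sub_left (hgi _ _) (hgi _ _)
  set m := (∫ x in (0 : ℝ)..(2 * Real.pi), H x) / (2 * Real.pi) with hm
  have hFsub : ∀ c d, (H d - m) - (H c - m) = ∫ t in c..d, g t := fun c d => by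
    rw [sub_sub_sub_cancel_right, hHsub]
  refine ⟨fun x => H x - m, g, A, by fun_prop, fun x => ?_, ?_, hgi, fun x => ?_, hFsub,
    fun c d h1 h2 h3 => (hFsub c d).trans (hleft c d h1 h2 h3),
    fun c d h1 h2 h3 => (hFsub c d).trans (hright c d h1 h2 (by linarith)),
    fun c d h1 h2 h3 => (hFsub c d).trans (hright' c d h1 h2 h3)⟩
  · have := hHsub x (x + 2 * Real.pi)
    rw [hgmean] at this
    simp only
    linarith
  · rw [intervalIntegral.integral_sub (hHc.intervalIntegrable _ _) (by simp)]
    simp only [intervalIntegral.integral_const, smul_eq_mul, sub_zero, hm]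
    field_simp
    ring
  · exact abs_periodicStep_le (abs_le.mpr ⟨by linarith, by linarith⟩)
      (abs_le.mpr ⟨by linarith, by linarith⟩) x

/-- A trigonometric polynomial of degree `n` that is `O(1/n)`-close to a Lipschitz function has
a bounded derivative. -/
lemma IsTrigPoly.abs_deriv_le_of_abs_sub_le {n : ℕ} (hn : 1 ≤ n) {P F : ℝ → ℝ}
    (hP : IsTrigPoly n P) {E : ℝ} (hE : n * E ≤ 1) (hPF : ∀ x, |P x - F x| ≤ E)
    (hF : ∀ c d, |F d - F c| ≤ 2 * |d - c|) (x : ℝ) : |_root_.deriv P x| ≤ 28 := by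
  have hn0 : (0 : ℝ) < n := by exact_mod_cast hn
  have hP' := hP.deriv
  have hPd : Differentiable ℝ P := (hP.contDiff (m := 1)).differentiable one_ne_zero
  have hP'd : Differentiable ℝ (_root_.deriv P) :=
    (hP'.contDiff (m := 1)).differentiable one_ne_zero
  obtain ⟨x₀, -, hx₀⟩ := isCompact_Icc.exists_isMaxOn (nonempty_Icc.mpr Real.two_pi_pos.le)
    (f := fun x => |_root_.deriv P x|) hP'd.continuous.abs.continuousOn
  set M := |_root_.deriv P x₀| with hMdef
  have hM : ∀ x, |_root_.deriv P x| ≤ M := by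
    intro x
    obtain ⟨z, hz, hxz⟩ := hP'.periodic.exists_mem_Ico₀ Real.two_pi_pos x
    rw [hxz]
    exact hx₀ ⟨hz.1, hz.2.le⟩
  refine (hM x).trans ?_
  have hM0 : 0 ≤ M := abs_nonneg _
  set t : ℝ := 1 / (6 * n) with ht
  have ht0 : 0 < t := by positivity
  have hnt : n * t = 1 / 6 := by rw [ht]; field_simp
  obtain ⟨ξ, ⟨hξ1, hξ2⟩, hξ⟩ := exists_deriv_eq_slope P (show x₀ < x₀ + t by linarith)
    hPd.continuous.continuousOn hPd.differentiableOn
  rw [add_sub_cancel_left] at hξ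
  have hvar : |_root_.deriv P ξ - _root_.deriv P x₀| ≤ 3 * n * M * |ξ - x₀| := by
    simpa using convex_univ.norm_image_sub_le_of_norm_deriv_le (f := _root_.deriv P)
      (fun z _ => hP'd z) (fun z _ => hP'.abs_deriv_le hn hM z) (mem_univ x₀) (mem_univ ξ)
  rw [abs_of_pos (by linarith : 0 < ξ - x₀)] at hvar
  have hvar' : 3 * n * M * (ξ - x₀) ≤ M / 2 := by
    calc 3 * n * M * (ξ - x₀) ≤ 3 * n * M * t := by gcongr; linarith
      _ = M / 2 := by linear_combination 3 * M * hnt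
  have hlow : M / 2 ≤ |_root_.deriv P ξ| := by
    have := abs_sub_abs_le_abs_sub (_root_.deriv P x₀) (_root_.deriv P ξ)
    rw [abs_sub_comm] at this
    linarith
  rw [hξ, abs_div, abs_of_pos ht0, le_div_iff₀ ht0] at hlow
  have hup : |P (x₀ + t) - P x₀| ≤ 2 * t + 2 * E := by
    have h1 := hF x₀ (x₀ + t)
    rw [add_sub_cancel_left, abs_of_pos ht0] at h1
    obtain ⟨a1, a2⟩ := abs_le.mp h1
    obtain ⟨b1, b2⟩ := abs_le.mp (hPF x₀)
    obtain ⟨c1, c2⟩ := abs_le.mp (hPF (x₀ + t))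
    exact abs_le.mpr ⟨by linarith, by linarith⟩
  have hfin : n * (M / 2 * t) ≤ n * (2 * t + 2 * E) :=
    mul_le_mul_of_nonneg_left (hlow.trans hup) hn0.le
  have e1 : n * (M / 2 * t) = M / 12 := by linear_combination M / 2 * hnt
  have e2 : n * (2 * t + 2 * E) = 1 / 3 + 2 * (n * E) := by linear_combination 2 * hnt
  linarith

/-- A trigonometric polynomial of degree `n`, concave to the left of `b`, cannot be closer than
`O(1/n)` to a Lipschitz function with a convex corner at `b`. -/
lemma IsTrigPoly.le_mul_of_corner {n : ℕ} (hn : 1 ≤ n) {P F : ℝ → ℝ} (hP : IsTrigPoly n P)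
    {a b r A E : ℝ} (hab : a < b) (hr : 0 < r) (hPF : ∀ x, |P x - F x| ≤ E)
    (hF : ∀ c d, |F d - F c| ≤ 2 * |d - c|) (hconc : ConcaveOn ℝ (Icc a b) P)
    (hleft : F b - F a = (b - a) * -A)
    (hright : ∀ t, 0 ≤ t → t ≤ r → F (b + t) - F b = t * (2 - A)) :
    min (1 / 84) r / (2 * (1 + 1 / (b - a))) ≤ n * E := by
  have hn1 : (1 : ℝ) ≤ n := by exact_mod_cast hn
  have hn0 : (0 : ℝ) < n := by linarith
  have hba : 0 < b - a := by linarith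
  have hE0 : 0 ≤ E := (abs_nonneg _).trans (hPF 0)
  set τ := min (1 / 84) r with hτ
  have hτ0 : 0 < τ := lt_min (by norm_num) hr
  have hτ84 : τ ≤ 1 / 84 := min_le_left _ _
  have hinv : 0 < 1 / (b - a) := by positivity
  rw [div_le_iff₀ (by positivity)]
  rcases le_total 1 (n * E) with hnE | hnE
  · nlinarith
  have hP' := hP.deriv
  have hPd : Differentiable ℝ P := (hP.contDiff (m := 1)).differentiable one_ne_zero
  have hP'd : Differentiable ℝ (_root_.deriv P) :=
    (hP'.contDiff (m := 1)).differentiable one_ne_zero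
  have hM := hP.abs_deriv_le_of_abs_sub_le hn hnE hPF hF
  set t := τ / n with ht
  have hnt : n * t = τ := by rw [ht]; field_simp
  have ht0 : 0 < t := by positivity
  have htτ : t ≤ τ := div_le_self hτ0.le hn1
  have hslope : _root_.deriv P b ≤ -A + 2 * E * (1 / (b - a)) := by
    have h := hconc.deriv_le_slope ⟨le_rfl, hab.le⟩ ⟨hab.le, le_rfl⟩ hab (hPd b)
    refine h.trans ?_
    rw [slope_def_field, div_le_iff₀ hba]
    have e : (-A + 2 * E * (1 / (b - a))) * (b - a) = (b - a) * -A + 2 * E := by field_simp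
    rw [e, ← hleft]
    linarith [(abs_le.mp (hPF a)).1, (abs_le.mp (hPF b)).2]
  obtain ⟨ξ, ⟨hξ1, hξ2⟩, hξ⟩ := exists_deriv_eq_slope P (show b < b + t by linarith)
    hPd.continuous.continuousOn hPd.differentiableOn
  rw [add_sub_cancel_left, eq_div_iff ht0.ne'] at hξ
  have hvar : |_root_.deriv P ξ - _root_.deriv P b| ≤ 3 * n * 28 * |ξ - b| := by
    simpa using convex_univ.norm_image_sub_le_of_norm_deriv_le (f := _root_.deriv P)
      (fun z _ => hP'd z) (fun z _ => hP'.abs_deriv_le hn hM z) (mem_univ b) (mem_univ ξ)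
  rw [abs_of_pos (by linarith : 0 < ξ - b)] at hvar
  have hvar' : _root_.deriv P ξ - _root_.deriv P b ≤ 1 := by
    calc _root_.deriv P ξ - _root_.deriv P b ≤ 3 * n * 28 * (ξ - b) := (le_abs_self _).trans hvar
      _ ≤ 3 * n * 28 * t := by gcongr; linarith
      _ = 84 * τ := by linear_combination 84 * hnt
      _ ≤ 1 := by linarith
  have hFr := hright t ht0.le (htτ.trans (min_le_right _ _))
  have hlow : t * (2 - A) - 2 * E ≤ P (b + t) - P b := by
    linarith [(abs_le.mp (hPF (b + t))).1, (abs_le.mp (hPF b)).2]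
  rw [← hξ] at hlow
  have hup : _root_.deriv P ξ * t ≤ (-A + 2 * E * (1 / (b - a)) + 1) * t :=
    mul_le_mul_of_nonneg_right (by linarith) ht0.le
  have hEt : E * (1 / (b - a)) * t ≤ E * (1 / (b - a)) * 1 :=
    mul_le_mul_of_nonneg_left (by linarith) (by positivity)
  have hkey : t ≤ E * (2 * (1 + 1 / (b - a))) := by nlinarith
  calc τ = n * t := hnt.symm
    _ ≤ n * (E * (2 * (1 + 1 / (b - a)))) := by gcongr
    _ = _ := by ring

lemma iteratedDerivWithin_Ioo_const_mul {m : ℕ} (φ : ℝ → ℝ) (σ : ℝ) (a b : ℝ) :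
    EqOn (iteratedDerivWithin m (fun x => σ * φ x) (Ioo a b))
      (fun x => σ * iteratedDeriv m φ x) (Ioo a b) := by
  intro x hx
  rw [iteratedDerivWithin_of_isOpen isOpen_Ioo hx, iteratedDeriv_const_mul_field]

lemma deltaQ_of_affine {m s : ℕ} (Y : PtsColl s) {f : ℝ → ℝ} (hf : ContDiff ℝ (m + 1 : ℕ) f)
    (hper : Function.Periodic f (2 * Real.pi))
    (haff : ∀ i, 1 ≤ i → i ≤ 2 * s → ∃ u w : ℝ, ∀ x ∈ Icc (Y.y i) (Y.y (i - 1)),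
      iteratedDeriv (m + 1) f x = u * x + w) : DeltaQ (m + 3) s Y f := by
  refine ⟨hf.continuous, hper, fun i hi1 hi2 =>
    ⟨(continuous_const.mul hf.continuous).continuousOn, ContDiff.contDiffOn ?_, ?_⟩⟩
  · exact contDiff_const.mul hf
  · obtain ⟨u, w, huw⟩ := haff i hi1 hi2
    have h : EqOn (fun x => (-1 : ℝ) ^ (i - 1) * u * x + (-1 : ℝ) ^ (i - 1) * w)
        (iteratedDerivWithin (m + 1) (fun x => (-1 : ℝ) ^ (i - 1) * f x)
          (Ioo (Y.y i) (Y.y (i - 1)))) (Ioo (Y.y i) (Y.y (i - 1))) := by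
      intro x hx
      rw [iteratedDerivWithin_Ioo_const_mul f _ _ _ hx]
      simp only
      rw [huw x (Ioo_subset_Icc_self hx)]
      ring
    refine ConvexOn.congr ⟨convex_Ioo _ _, fun x _ y _ p r _ _ hpr => ?_⟩ h
    simp only [smul_eq_mul]
    exact le_of_eq (by linear_combination (-((-1 : ℝ) ^ (i - 1) * w)) * hpr)

lemma DeltaQ.convexOn_Icc {m s n : ℕ} {Y : PtsColl s} {T : ℝ → ℝ} (hT : DeltaQ (m + 3) s Y T)
    (hTn : IsTrigPoly n T) {i : ℕ} (hi1 : 1 ≤ i) (hi2 : i ≤ 2 * s) :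
    ConvexOn ℝ (Icc (Y.y i) (Y.y (i - 1)))
      (fun x => (-1 : ℝ) ^ (i - 1) * iteratedDeriv (m + 1) T x) := by
  have hc : Continuous (iteratedDeriv (m + 1) T) :=
    ((hTn.iteratedDeriv _).contDiff (m := 0)).continuous
  refine ConvexOn.Icc_of_Ioo (Y.lt i hi1 hi2) (by fun_prop) ?_
  exact (hT.2.2 i hi1 hi2).2.2.congr (iteratedDerivWithin_Ioo_const_mul T _ _ _)

/-- **Theorem 1.4.** For each `q ≥ 3`, `s ∈ ℕ` and any `Y_s ∈ 𝕐_s`, there exists a function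
`f ∈ Δ^(q)(Y_s) ∩ W^{q-1}` and a constant `C = C(q, Y_s) > 0` such that
`n · E_n^(q)(f, Y_s) ≥ C` for all `n ∈ ℕ`. -/
theorem lower_bound_W_q_sub_one (q s : ℕ) (hq : 3 ≤ q) (hs : 1 ≤ s) (Y : PtsColl s) :
    ∃ f : ℝ → ℝ, ∃ C : ℝ, 0 < C ∧ DeltaQ q s Y f ∧ SobolevW (q - 1) f ∧
      ∀ n : ℕ, 1 ≤ n → C ≤ (n : ℝ) * ErrCoQ q n s Y f := by
  obtain ⟨m, rfl⟩ : ∃ m, q = m + 3 := ⟨q - 3, by omega⟩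
  obtain ⟨F, g, A, hFc, hFper, hFmean, hgi, hg2, hFg, hFleft, hFright, hFrest⟩ :=
    exists_piecewise_linear hs Y
  obtain ⟨f, hf, hfper, hfF⟩ :=
    exists_periodic_iteratedDeriv_eq Real.two_pi_pos (m + 1) hFc hFper hFmean
  obtain ⟨K, hK, hKφ⟩ := exists_abs_iteratedDeriv_le_of_alternating (m + 1) hs Y
  have h21 : Y.y 2 < Y.y 1 := Y.lt 2 (by omega) (by omega)
  have h10 : Y.y 1 < Y.y 0 := Y.lt 1 le_rfl (by omega)
  have hba : 0 < Y.y 1 - Y.y 2 := by linarith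
  have hr : 0 < Y.y 0 - Y.y 1 := by linarith
  have haff : ∀ i, 1 ≤ i → i ≤ 2 * s → ∃ u w : ℝ, ∀ x ∈ Icc (Y.y i) (Y.y (i - 1)),
      F x = u * x + w := by
    intro i hi1 hi2
    suffices ∃ v, ∀ x ∈ Icc (Y.y i) (Y.y (i - 1)), F x - F (Y.y i) = (x - Y.y i) * v by
      obtain ⟨v, hv⟩ := this
      exact ⟨v, F (Y.y i) - Y.y i * v, fun x hx => by linear_combination hv x hx⟩
    rcases Nat.lt_or_ge 2 i with hi | hi
    · exact ⟨_, fun x hx => hFrest _ _ (Y.y_le hi2 le_rfl) hx.1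
        (hx.2.trans (Y.y_le (by omega) (by omega)))⟩
    · interval_cases i
      · exact ⟨_, fun x hx => hFright _ _ le_rfl hx.1 hx.2⟩
      · exact ⟨_, fun x hx => hFleft _ _ le_rfl hx.1 hx.2⟩
  have hFlip : ∀ c d, |F d - F c| ≤ 2 * |d - c| := fun c d => by
    rw [hFg, ← Real.norm_eq_abs (∫ t in c..d, g t)]
    exact intervalIntegral.norm_integral_le_of_norm_le_const fun x _ => hg2 x
  set c₀ := min (1 / 84) (Y.y 0 - Y.y 1) / (2 * (1 + 1 / (Y.y 1 - Y.y 2))) with hc₀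
  have hc₀0 : 0 < c₀ := by
    have : 0 < min (1 / 84) (Y.y 0 - Y.y 1) := lt_min (by norm_num) hr
    positivity
  refine ⟨f, c₀ / K, by positivity, deltaQ_of_affine Y hf hfper (by rw [hfF]; exact haff),
    ⟨hfper, hf, g, hgi, Eventually.of_forall hg2, fun x => ?_⟩, fun n hn => ?_⟩
  · change iteratedDeriv (m + 1) f x = iteratedDeriv (m + 1) f 0 + _
    rw [hfF, ← hFg]
    ring
  have hn0 : (0 : ℝ) < n := by exact_mod_cast hn
  rw [← div_le_iff₀' hn0]
  refine le_csInf ?_ ?_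
  · refine ⟨_, fun _ => 0, ⟨isTrigPoly_zero n, deltaQ_of_affine Y contDiff_const (fun _ => rfl)
      fun i _ _ => ⟨0, 0, fun x _ => ?_⟩⟩, rfl⟩
    simp
  rintro _ ⟨T, ⟨hT, hTY⟩, rfl⟩
  set ε := ⨆ x, |f x - T x| with hε
  have hTper : Function.Periodic T (2 * Real.pi) := hT.periodic
  have hφper : Function.Periodic (fun x => T x - f x) (2 * Real.pi) := fun x => by
    simp only [hTper x, hfper x]
  have hTc : ContDiff ℝ (m + 1 : ℕ) T := hT.contDiff
  have hbdd : BddAbove (range fun x => |f x - T x|) := by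
    have hc : Continuous fun x => |f x - T x| := (hf.continuous.sub hTc.continuous).abs
    have hp : Function.Periodic (fun x => |f x - T x|) (2 * Real.pi) := fun x => by
      simp only [hTper x, hfper x]
    exact (hp.compact_of_continuous Real.two_pi_pos.ne' hc).bddAbove
  have hεφ : ∀ x, |T x - f x| ≤ ε := fun x => by
    rw [abs_sub_comm]; exact le_ciSup hbdd x
  have hsub : iteratedDeriv (m + 1) (fun x => T x - f x) =
      fun x => iteratedDeriv (m + 1) T x - F x := by
    funext x
    rw [iteratedDeriv_fun_sub hTc.contDiffAt hf.contDiffAt, hfF]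
  have hPF : ∀ x, |iteratedDeriv (m + 1) T x - F x| ≤ K * ε := by
    have h := hKφ (fun x => T x - f x) ε (hTc.sub hf) hφper hεφ ?_
    · simpa only [hsub] using h
    intro i hi1 hi2
    rw [hsub]
    obtain ⟨u, w, huw⟩ := haff i hi1 hi2
    refine ⟨convex_Icc _ _, fun x hx y hy p r hp hr hpr => ?_⟩
    have h := (hTY.convexOn_Icc hT hi1 hi2).2 hx hy hp hr hpr
    have hxy := convex_Icc (Y.y i) (Y.y (i - 1)) hx hy hp hr hpr
    simp only [smul_eq_mul] at h hxy ⊢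
    rw [huw _ hxy, huw x hx, huw y hy]
    linear_combination h + (-1 : ℝ) ^ (i - 1) * w * hpr
  have hconc : ConcaveOn ℝ (Icc (Y.y 2) (Y.y 1)) (iteratedDeriv (m + 1) T) := by
    have h := (hTY.convexOn_Icc hT (i := 2) (by omega) (by omega)).neg
    refine h.congr fun x _ => ?_
    simp
  have hmain := (hT.iteratedDeriv (m + 1)).le_mul_of_corner hn h21 hr hPF hFlip hconc
    (hFleft _ _ le_rfl h21.le le_rfl) fun t ht0 ht1 => by
      rw [hFright _ _ le_rfl (by linarith) (by linarith), add_sub_cancel_left]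
  rw [div_div, div_le_iff₀ (by positivity)]
  linarith
end
end

section
/- For each integer q ≥ 3 there exists a constant c > 0 (depending only on q) such that for every function g : [−1,1] → ℝ that is (q−2)-times continuously differentiable with g^{(q−2)} convex on [0,1] and g^{(q−2)} concave on [−1,0], one has max_{x∈[−1,1]} |F_{q−2}(x) − g(x)| ≥ c. -/
noncomputable section

/-- `F_r(x) = |x| x^{r-1} / r!`. -/
def Fr (r : ℕ) (x : ℝ) : ℝ := |x| * x ^ (r - 1) / (Nat.factorial r)

open Set

/-- A function bounded by `ε` on an interval of length `l` has its `n`-th derivative bounded by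
`C ε` at some point of this interval, where `C` depends only on `n` and `l`. -/
theorem exists_abs_deriv_chain_le (n : ℕ) : ∀ l : ℝ, 0 < l → ∃ C : ℝ, 0 < C ∧
    ∀ (a ε : ℝ) (f : ℕ → ℝ → ℝ),
      (∀ k < n, ∀ x ∈ Icc a (a + l), HasDerivAt (f k) (f (k + 1) x) x) →
      (∀ x ∈ Icc a (a + l), |f 0 x| ≤ ε) → ∃ x ∈ Icc a (a + l), |f n x| ≤ C * ε := by
  induction n with
  | zero =>
    intro l hl
    refine ⟨1, one_pos, fun a ε f _ hb => ⟨a, ⟨le_rfl, by linarith⟩, ?_⟩⟩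
    simpa using hb a ⟨le_rfl, by linarith⟩
  | succ n ih =>
    intro l hl
    obtain ⟨C, hC, h⟩ := ih (l / 3) (by positivity)
    refine ⟨6 * C / l, by positivity, fun a ε f hd hb => ?_⟩
    have sub_left : Icc a (a + l / 3) ⊆ Icc a (a + l) := Icc_subset_Icc le_rfl (by linarith)
    have sub_right : Icc (a + 2 * l / 3) (a + 2 * l / 3 + l / 3) ⊆ Icc a (a + l) :=
      Icc_subset_Icc (by linarith) (by linarith)
    obtain ⟨u, hu, hfu⟩ := h a ε f (fun k hk x hx => hd k (by omega) x (sub_left hx))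
      (fun x hx => hb x (sub_left hx))
    obtain ⟨v, hv, hfv⟩ := h (a + 2 * l / 3) ε f
      (fun k hk x hx => hd k (by omega) x (sub_right hx)) (fun x hx => hb x (sub_right hx))
    have huv : l / 3 ≤ v - u := by linarith [hu.2, hv.1]
    have sub_uv : Icc u v ⊆ Icc a (a + l) := Icc_subset_Icc hu.1 (sub_right hv).2
    obtain ⟨x, hx, hfx⟩ := exists_hasDerivAt_eq_slope (f n) (f (n + 1)) (by linarith : u < v)
      (fun x hx => (hd n (by omega) x (sub_uv hx)).continuousAt.continuousWithinAt)
      (fun x hx => hd n (by omega) x (sub_uv (Ioo_subset_Icc_self hx)))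
    refine ⟨x, sub_uv (Ioo_subset_Icc_self hx), ?_⟩
    have hdiff : |f n v - f n u| ≤ 2 * C * ε := by
      linarith [abs_sub (f n v) (f n u)]
    have hε : 0 ≤ 2 * C * ε := (abs_nonneg _).trans hdiff
    rw [hfx, abs_div, abs_of_pos (by linarith : 0 < v - u)]
    calc |f n v - f n u| / (v - u) ≤ 2 * C * ε / (l / 3) := by gcongr
      _ = 6 * C / l * ε := by field_simp; ring

theorem hasDerivAt_pow_sub_div_factorial {r k : ℕ} (hk : k < r) (x : ℝ) :
    HasDerivAt (fun y : ℝ => y ^ (r - k) / (r - k).factorial)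
      (x ^ (r - (k + 1)) / (r - (k + 1)).factorial) x := by
  obtain ⟨m, rfl⟩ : ∃ m, r = k + 1 + m := ⟨r - (k + 1), by omega⟩
  have h1 : k + 1 + m - k = m + 1 := by omega
  have h2 : k + 1 + m - (k + 1) = m := by omega
  rw [h1, h2]
  refine ((hasDerivAt_pow (m + 1) x).div_const ((m + 1).factorial : ℝ)).congr_deriv ?_
  have := Nat.factorial_pos m
  rw [Nat.factorial_succ]
  push_cast
  field_simp

theorem ContDiffOn.hasDerivAt_iteratedDerivWithin {n k : ℕ} {g : ℝ → ℝ} {s : Set ℝ} {x : ℝ}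
    (hg : ContDiffOn ℝ n g s) (hs : UniqueDiffOn ℝ s) (hk : k < n) (hx : s ∈ nhds x) :
    HasDerivAt (iteratedDerivWithin k g s) (iteratedDerivWithin (k + 1) g s x) x := by
  rw [iteratedDerivWithin_succ]
  exact ((hg.differentiableOn_iteratedDerivWithin (by exact_mod_cast hk) hs) x
    (mem_of_mem_nhds hx)).hasDerivWithinAt.hasDerivAt hx

/-- If `g` is uniformly close to `s x ^ r / r!` on an interval of length `l`, then its `r`-th
derivative is close to `s` at some point of this interval. -/
theorem exists_abs_sub_iteratedDerivWithin_le (r : ℕ) {l : ℝ} (hl : 0 < l) : ∃ C : ℝ, 0 < C ∧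
    ∀ (g : ℝ → ℝ) (s a ε : ℝ), ContDiffOn ℝ r g (Icc (-1 : ℝ) 1) → -1 < a → a + l < 1 →
      (∀ x ∈ Icc a (a + l), |s * (x ^ r / r.factorial) - g x| ≤ ε) →
      ∃ x ∈ Icc a (a + l), |s - iteratedDerivWithin r g (Icc (-1 : ℝ) 1) x| ≤ C * ε := by
  obtain ⟨C, hC, h⟩ := exists_abs_deriv_chain_le r l hl
  refine ⟨C, hC, fun g s a ε hg ha hal hb => ?_⟩
  obtain ⟨x, hx, hfx⟩ := h a ε (fun k y => s * (y ^ (r - k) / (r - k).factorial) -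
    iteratedDerivWithin k g (Icc (-1 : ℝ) 1) y)
    (fun k hk x hx => ((hasDerivAt_pow_sub_div_factorial hk x).const_mul s).sub
      (hg.hasDerivAt_iteratedDerivWithin (uniqueDiffOn_Icc (by norm_num)) hk
        (Icc_mem_nhds (by linarith [hx.1]) (by linarith [hx.2]))))
    (fun x hx => by simpa using hb x hx)
  exact ⟨x, hx, by simpa using hfx⟩

/-- A convex function on `[0, 1]` which is close to `1` at two well-separated interior points
cannot be much less than `1` at the origin. -/
theorem ConvexOn.one_sub_le_of_abs_one_sub_le {h : ℝ → ℝ} (hh : ConvexOn ℝ (Icc (0 : ℝ) 1) h)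
    {u v δ : ℝ} (hu : u ∈ Icc (1 / 8 : ℝ) (1 / 4)) (hv : v ∈ Icc (1 / 2 : ℝ) (5 / 8))
    (hhu : |1 - h u| ≤ δ) (hhv : |1 - h v| ≤ δ) : 1 - h 0 ≤ 4 * δ := by
  obtain ⟨hu1, hu2⟩ := hu
  obtain ⟨hv1, hv2⟩ := hv
  have hδ : 0 ≤ δ := (abs_nonneg _).trans hhu
  have hv0 : 0 < v := by linarith
  have key := hh.2 (⟨le_rfl, zero_le_one⟩ : (0 : ℝ) ∈ Icc (0 : ℝ) 1)
    (⟨hv0.le, by linarith⟩ : v ∈ Icc (0 : ℝ) 1)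
    (div_nonneg (by linarith) hv0.le : 0 ≤ (v - u) / v)
    (div_nonneg (by linarith) hv0.le : 0 ≤ u / v) (by field_simp; ring)
  have hc : ((v - u) / v) • (0 : ℝ) + (u / v) • v = u := by
    simp only [smul_eq_mul]; field_simp; ring
  rw [hc] at key
  have key' : v * h u ≤ (v - u) * h 0 + u * h v := by
    have := mul_le_mul_of_nonneg_left key hv0.le
    simp only [smul_eq_mul] at this
    calc v * h u ≤ _ := this
      _ = _ := by field_simp
  rw [abs_le] at hhu hhv
  have h1 : v * (1 - δ) ≤ v * h u := by gcongr; linarith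
  have h2 : u * h v ≤ u * (1 + δ) := by gcongr; linarith
  by_contra! hlt
  nlinarith [mul_lt_mul_of_pos_left hlt (by linarith : 0 < v - u)]

/-- **Lemma 2.4 (from [LS]).** For each `q ≥ 3` there is a constant `c = c(q) > 0` such that
for any `g ∈ C^{q-2}[-1,1]` with `g^{(q-2)}` convex on `[0,1]` and concave on `[-1,0]`,
we have `max_{x ∈ [-1,1]} |F_{q-2}(x) - g(x)| ≥ c`. -/
theorem dist_to_co_convex_on_unit_interval (q : ℕ) (hq : 3 ≤ q) :
    ∃ c : ℝ, 0 < c ∧ ∀ g : ℝ → ℝ,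
      ContDiffOn ℝ (q - 2 : ℕ) g (Set.Icc (-1 : ℝ) 1) →
      ConvexOn ℝ (Set.Icc (0 : ℝ) 1) (iteratedDerivWithin (q - 2) g (Set.Icc (-1 : ℝ) 1)) →
      ConcaveOn ℝ (Set.Icc (-1 : ℝ) 0) (iteratedDerivWithin (q - 2) g (Set.Icc (-1 : ℝ) 1)) →
      c ≤ sSup ((fun x => |Fr (q - 2) x - g x|) '' Set.Icc (-1 : ℝ) 1) := by
  obtain ⟨C, hC, hclose⟩ := exists_abs_sub_iteratedDerivWithin_le (q - 2)
    (by norm_num : (0 : ℝ) < 1 / 8)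
  refine ⟨1 / (4 * C), by positivity, fun g hg hconv hconc => ?_⟩
  set S := Set.Icc (-1 : ℝ) 1
  set ε := sSup ((fun x => |Fr (q - 2) x - g x|) '' S)
  set h := iteratedDerivWithin (q - 2) g S
  have hcont : ContinuousOn (fun x => |Fr (q - 2) x - g x|) S := by
    have hF : Continuous (Fr (q - 2)) := by unfold Fr; fun_prop
    exact (hF.continuousOn.sub hg.continuousOn).abs
  have hbound : ∀ x ∈ S, |Fr (q - 2) x - g x| ≤ ε := fun x hx =>
    le_csSup (isCompact_Icc.image_of_continuousOn hcont).bddAbove (mem_image_of_mem _ hx)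
  have hr : q - 2 = q - 2 - 1 + 1 := by omega
  have hpos : ∀ x ∈ S, 0 ≤ x → |1 * (x ^ (q - 2) / (q - 2).factorial) - g x| ≤ ε := by
    intro x hx hx0
    have := hbound x hx
    rwa [Fr, abs_of_nonneg hx0, ← pow_succ', ← hr, ← one_mul (_ / _)] at this
  have hneg : ∀ x ∈ S, x ≤ 0 → |-1 * (x ^ (q - 2) / (q - 2).factorial) - g x| ≤ ε := by
    intro x hx hx0
    have := hbound x hx
    rwa [Fr, abs_of_nonpos hx0, neg_mul, ← pow_succ', ← hr, neg_div, ← neg_one_mul] at this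
  have exists_pos : ∀ a : ℝ, 0 ≤ a → a + 1 / 8 < 1 →
      ∃ x ∈ Icc a (a + 1 / 8), |1 - h x| ≤ C * ε := fun a ha ha' =>
    hclose g 1 a ε hg (by linarith) ha' fun x hx =>
      hpos x ⟨by linarith [hx.1], by linarith [hx.2]⟩ (by linarith [hx.1])
  have exists_neg : ∀ a : ℝ, -1 < a → a + 1 / 8 ≤ 0 →
      ∃ x ∈ Icc a (a + 1 / 8), |-1 - h x| ≤ C * ε := fun a ha ha' =>
    hclose g (-1) a ε hg ha (by linarith) fun x hx =>
      hneg x ⟨by linarith [hx.1], by linarith [hx.2]⟩ (by linarith [hx.2])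
  obtain ⟨u, hu, hhu⟩ := exists_pos (1 / 8) (by norm_num) (by norm_num)
  obtain ⟨v, hv, hhv⟩ := exists_pos (1 / 2) (by norm_num) (by norm_num)
  obtain ⟨u', hu', hhu'⟩ := exists_neg (-1 / 4) (by norm_num) (by norm_num)
  obtain ⟨v', hv', hhv'⟩ := exists_neg (-5 / 8) (by norm_num) (by norm_num)
  have hright : 1 - h 0 ≤ 4 * (C * ε) := hconv.one_sub_le_of_abs_one_sub_le
    ⟨hu.1, by linarith [hu.2]⟩ ⟨hv.1, by linarith [hv.2]⟩ hhu hhv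
  have hreflect : ConvexOn ℝ (Icc (0 : ℝ) 1) fun x => -h (-x) := by
    refine ⟨convex_Icc 0 1, fun x hx y hy a b ha hb hab => ?_⟩
    have := hconc.2 (⟨by linarith [hx.2], by linarith [hx.1]⟩ : -x ∈ Icc (-1 : ℝ) 0)
      (⟨by linarith [hy.2], by linarith [hy.1]⟩ : -y ∈ Icc (-1 : ℝ) 0) ha hb hab
    have harg : a • -x + b • -y = -(a • x + b • y) := by
      simp only [smul_eq_mul]; ring
    rw [harg] at this
    simp only [smul_eq_mul] at this ⊢
    linarith
  have abs_reflect : ∀ x, |-1 - h x| ≤ C * ε → |1 - -h (- -x)| ≤ C * ε := by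
    intro x hx
    rw [neg_neg, ← abs_neg]
    convert hx using 2
    ring
  have hleft : 1 - -h (-0) ≤ 4 * (C * ε) := hreflect.one_sub_le_of_abs_one_sub_le
    (u := -u') (v := -v') ⟨by linarith [hu'.2], by linarith [hu'.1]⟩
    ⟨by linarith [hv'.2], by linarith [hv'.1]⟩ (abs_reflect u' hhu') (abs_reflect v' hhv')
  rw [neg_zero] at hleft
  rw [div_le_iff₀ (by positivity)]
  linarith
end
end

section
/- For each b ∈ (0, π), each n ∈ ℕ and every odd trigonometric polynomial T of degree ≤ n (i.e., T(t) = Σ_{k=1}^n β_k sin kt with real β_k), one has max_{|t| ≤ b/2} |T′(t)| ≤ (10 n / b) · max_{|t| ≤ b} |T(t)|. -/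
noncomputable section

/-- The argument of `rieszNode N k`. -/
def rieszAngle (N k : ℕ) : ℝ := (2 * k + 1) * Real.pi / (2 * N)

/-- The `k`-th of the `2 * N` complex numbers `z` with `z ^ (2 * N) = -1`. -/
def rieszNode (N k : ℕ) : ℂ := Complex.exp (rieszAngle N k * Complex.I)

/-- The weight of the `k`-th node in M. Riesz's interpolation formula. -/
def rieszWeight (N k : ℕ) : ℝ :=
  (-1) ^ k * ‖∑ a ∈ Finset.range N, rieszNode N k ^ a‖ ^ 2 / (2 * N)

lemma rieszNode_pow {N : ℕ} (hN : N ≠ 0) (k : ℕ) :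
    rieszNode N k ^ N = (-1) ^ k * Complex.I := by
  have hN' : (N : ℂ) ≠ 0 := by exact_mod_cast hN
  rw [rieszNode, ← Complex.exp_nat_mul]
  have : (N : ℂ) * ((rieszAngle N k : ℝ) * Complex.I) =
      k * (Real.pi * Complex.I) + Real.pi / 2 * Complex.I := by
    simp only [rieszAngle]; push_cast; field_simp
  rw [this, Complex.exp_add, Complex.exp_nat_mul, Complex.exp_pi_mul_I,
    Complex.exp_pi_div_two_mul_I]

lemma rieszNode_pow_two_mul {N : ℕ} (hN : N ≠ 0) (k : ℕ) :
    rieszNode N k ^ (2 * N) = -1 := by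
  rw [mul_comm, pow_mul, rieszNode_pow hN, mul_pow, ← pow_mul, mul_comm k 2, pow_mul]
  simp

lemma norm_rieszNode (N k : ℕ) : ‖rieszNode N k‖ = 1 :=
  Complex.norm_exp_ofReal_mul_I _

lemma sum_rieszNode_pow {N m : ℕ} (hm : 0 < m) (hmN : m < 4 * N) :
    ∑ k ∈ Finset.range (2 * N), rieszNode N k ^ m = if m = 2 * N then -(2 * N : ℂ) else 0 := by
  have hN : N ≠ 0 := by lia
  have hN' : (N : ℂ) ≠ 0 := by exact_mod_cast hN
  split_ifs with h
  · simp [h, rieszNode_pow_two_mul hN]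
  · have hω : IsPrimitiveRoot (Complex.exp (2 * Real.pi * Complex.I / (2 * N : ℕ))) (2 * N) :=
      Complex.isPrimitiveRoot_exp _ (by lia)
    set ω := Complex.exp (2 * Real.pi * Complex.I / (2 * N : ℕ)) with hωd
    have hnode : ∀ k, rieszNode N k ^ m = rieszNode N 0 ^ m * (ω ^ m) ^ k := by
      intro k
      rw [← pow_mul, mul_comm m k, pow_mul, ← mul_pow]
      congr 1
      rw [rieszNode, rieszNode, hωd, ← Complex.exp_nat_mul, ← Complex.exp_add]
      congr 1
      simp only [rieszAngle]; push_cast; field_simp; ring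
    have hne : ω ^ m ≠ 1 := by
      rw [Ne, hω.pow_eq_one_iff_dvd]
      rintro ⟨c, rfl⟩
      have : c < 2 := by by_contra! hc; nlinarith
      interval_cases c <;> simp_all
    rw [Finset.sum_congr rfl fun k _ => hnode k, ← Finset.mul_sum, geom_sum_eq hne, ← pow_mul,
      mul_comm m, pow_mul, hω.pow_eq_one]
    simp

lemma sum_rieszNode_pow_mul_sq {N j : ℕ} (hj : j ≤ N) :
    ∑ k ∈ Finset.range (2 * N),
      rieszNode N k ^ (j + 1) * (∑ a ∈ Finset.range N, rieszNode N k ^ a) ^ 2 = -(2 * N * j) := by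
  have hcount : ∀ a ∈ Finset.range N,
      ∑ b ∈ Finset.range N, ∑ k ∈ Finset.range (2 * N), rieszNode N k ^ (j + 1 + a + b) =
        if N - j ≤ a then -(2 * N : ℂ) else 0 := by
    intro a ha
    rw [Finset.mem_range] at ha
    have : ∀ b ∈ Finset.range N,
        ∑ k ∈ Finset.range (2 * N), rieszNode N k ^ (j + 1 + a + b) =
          if b = 2 * N - 1 - j - a then (if N - j ≤ a then -(2 * N : ℂ) else 0) else 0 := by
      intro b hb
      rw [Finset.mem_range] at hb
      rw [sum_rieszNode_pow (by lia) (by lia)]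
      split_ifs <;> first | rfl | lia
    rw [Finset.sum_congr rfl this, Finset.sum_ite_eq']
    split_ifs with h1 h2 <;> first | rfl | (simp at h1; lia)
  calc _ = ∑ a ∈ Finset.range N, ∑ b ∈ Finset.range N, ∑ k ∈ Finset.range (2 * N),
        rieszNode N k ^ (j + 1 + a + b) := by
        simp_rw [sq, Finset.sum_mul_sum, Finset.mul_sum, ← pow_add]
        rw [Finset.sum_comm]
        refine Finset.sum_congr rfl fun a _ => ?_
        rw [Finset.sum_comm]
        simp only [add_assoc]
    _ = -(2 * N * j) := by
        rw [Finset.sum_congr rfl hcount, ← Finset.sum_filter]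
        have : (Finset.range N).filter (fun a => N - j ≤ a) = Finset.Ico (N - j) N := by
          ext a; simp; lia
        rw [this, Finset.sum_const, Nat.card_Ico, Nat.sub_sub_self hj, nsmul_eq_mul]
        ring

lemma rieszNode_mul_geom_sum_sq {N : ℕ} (hN : N ≠ 0) (k : ℕ) :
    rieszNode N k * (∑ a ∈ Finset.range N, rieszNode N k ^ a) ^ 2 =
      (-1) ^ k * Complex.I * (‖∑ a ∈ Finset.range N, rieszNode N k ^ a‖ : ℂ) ^ 2 := by
  set u := rieszNode N k with hu
  have huu : u * (starRingEnd ℂ) u = 1 := by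
    rw [Complex.mul_conj']; simp [hu, norm_rieszNode]
  have hg : u ^ N * (starRingEnd ℂ) (∑ a ∈ Finset.range N, u ^ a) =
      u * ∑ a ∈ Finset.range N, u ^ a := by
    rw [map_sum, Finset.mul_sum, Finset.mul_sum, ← Finset.sum_range_reflect (fun a => u * u ^ a)]
    refine Finset.sum_congr rfl fun a ha => ?_
    rw [Finset.mem_range] at ha
    obtain ⟨c, rfl⟩ : ∃ c, N = c + 1 + a := ⟨N - 1 - a, by lia⟩
    rw [show c + 1 + a - 1 - a = c by lia, map_pow]
    calc _ = u ^ (c + 1) * (u * (starRingEnd ℂ) u) ^ a := by ring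
      _ = _ := by rw [huu]; ring
  rw [← rieszNode_pow hN, ← Complex.mul_conj', ← hu]
  linear_combination (-(∑ a ∈ Finset.range N, u ^ a)) * hg

lemma sum_rieszWeight_mul_pow {N j : ℕ} (hN : N ≠ 0) (hj : j ≤ N) :
    ∑ k ∈ Finset.range (2 * N), (rieszWeight N k : ℂ) * rieszNode N k ^ j = j * Complex.I := by
  have hN' : (N : ℂ) ≠ 0 := by exact_mod_cast hN
  calc _ = ∑ k ∈ Finset.range (2 * N), -Complex.I / (2 * N) *
        (rieszNode N k ^ (j + 1) * (∑ a ∈ Finset.range N, rieszNode N k ^ a) ^ 2) := by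
        refine Finset.sum_congr rfl fun k _ => ?_
        rw [pow_succ, mul_assoc (rieszNode N k ^ j), rieszNode_mul_geom_sum_sq hN, rieszWeight]
        push_cast
        linear_combination ((-1) ^ k * (‖∑ a ∈ Finset.range N, rieszNode N k ^ a‖ : ℂ) ^ 2
          / (2 * N) * rieszNode N k ^ j) * Complex.I_sq
    _ = _ := by
        rw [← Finset.mul_sum, sum_rieszNode_pow_mul_sq hj]
        field_simp

lemma sum_abs_rieszWeight {N : ℕ} (hN : N ≠ 0) :
    ∑ k ∈ Finset.range (2 * N), |rieszWeight N k| = N := by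
  have habs : ∀ k, ((|rieszWeight N k| : ℝ) : ℂ) =
      -Complex.I * ((rieszWeight N k : ℂ) * rieszNode N k ^ N) := by
    intro k
    have : |rieszWeight N k| = (-1) ^ k * rieszWeight N k := by
      rw [rieszWeight, abs_div, abs_mul, abs_pow, abs_neg, abs_one, one_pow, abs_of_nonneg
        (by positivity : (0 : ℝ) ≤ ‖_‖ ^ 2), abs_of_nonneg (by positivity : (0 : ℝ) ≤ 2 * N),
        ← mul_div_assoc, ← mul_assoc, ← pow_add, ← two_mul, pow_mul]
      simp
    rw [rieszNode_pow hN, this]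
    push_cast
    linear_combination ((-1) ^ k * (rieszWeight N k : ℂ)) * Complex.I_sq
  apply Complex.ofReal_injective
  push_cast
  simp_rw [habs]
  rw [← Finset.mul_sum, sum_rieszWeight_mul_pow hN le_rfl]
  linear_combination (-(N : ℂ)) * Complex.I_sq

/-- The real trigonometric polynomials of degree at most `N`, as functions. -/
def trigPolyLE (N : ℕ) : Submodule ℝ (ℝ → ℝ) :=
  Submodule.span ℝ {f | ∃ j ≤ N, ∃ δ : ℝ, f = fun φ => Real.cos (j * φ + δ)}

/-- **M. Riesz's interpolation formula** for the derivative of a trigonometric polynomial. -/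
lemma hasDerivAt_of_mem_trigPolyLE {N : ℕ} (hN : N ≠ 0) {S : ℝ → ℝ} (hS : S ∈ trigPolyLE N)
    (φ : ℝ) :
    HasDerivAt S (∑ k ∈ Finset.range (2 * N), rieszWeight N k * S (φ + rieszAngle N k)) φ := by
  induction hS using Submodule.span_induction with
  | mem f hf =>
    obtain ⟨j, hj, δ, rfl⟩ := hf
    have h : HasDerivAt (fun φ : ℝ => Real.cos (j * φ + δ)) (-Real.sin (j * φ + δ) * (j * 1)) φ :=
      (((hasDerivAt_id φ).const_mul (j : ℝ)).add_const δ).cos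
    convert h using 1
    have key := congrArg (fun z => (Complex.exp ((j * φ + δ : ℝ) * Complex.I) * z).re)
      (sum_rieszWeight_mul_pow hN hj)
    have hterm : ∀ k, (Complex.exp ((j * φ + δ : ℝ) * Complex.I) *
        ((rieszWeight N k : ℂ) * rieszNode N k ^ j)).re =
          rieszWeight N k * Real.cos (j * (φ + rieszAngle N k) + δ) := by
      intro k
      rw [mul_left_comm, Complex.re_ofReal_mul, rieszNode, ← Complex.exp_nat_mul, ← Complex.exp_add,
        ← Complex.exp_ofReal_mul_I_re]
      congr 3
      push_cast
      ring
    rw [Finset.mul_sum, Complex.re_sum, Finset.sum_congr rfl fun k _ => hterm k] at key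
    rw [key, mul_left_comm, ← Complex.ofReal_natCast, Complex.re_ofReal_mul, Complex.mul_I_re,
      Complex.exp_ofReal_mul_I_im]
    ring
  | zero => simp
  | add f g _ _ hf hg =>
    refine (hf.add hg).congr_deriv ?_
    simp [mul_add, Finset.sum_add_distrib]
  | smul c f _ hf =>
    refine (hf.const_smul c).congr_deriv ?_
    simp [Finset.mul_sum, mul_left_comm]

/-- **Bernstein's inequality** for trigonometric polynomials. -/
lemma abs_deriv_le_of_mem_trigPolyLE {N : ℕ} (hN : N ≠ 0) {S : ℝ → ℝ} (hS : S ∈ trigPolyLE N)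
    {M : ℝ} (hM : ∀ φ, |S φ| ≤ M) (φ : ℝ) : |deriv S φ| ≤ N * M := by
  rw [(hasDerivAt_of_mem_trigPolyLE hN hS φ).deriv, ← sum_abs_rieszWeight hN, Finset.sum_mul]
  refine (Finset.abs_sum_le_sum_abs _ _).trans (Finset.sum_le_sum fun k _ => ?_)
  rw [abs_mul]
  exact mul_le_mul_of_nonneg_left (hM _) (abs_nonneg _)

lemma trigPolyLE_mono : Monotone trigPolyLE := fun _ _ h =>
  Submodule.span_mono fun _ ⟨j, hj, δ, hf⟩ => ⟨j, hj.trans h, δ, hf⟩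

lemma sin_mul_mem_trigPolyLE {N : ℕ} {S : ℝ → ℝ} (hS : S ∈ trigPolyLE N) :
    (fun φ => Real.sin φ * S φ) ∈ trigPolyLE (N + 1) := by
  induction hS using Submodule.span_induction with
  | mem f hf =>
    obtain ⟨j, hj, δ, rfl⟩ := hf
    have hmem : ∀ i ≤ N + 1, ∀ ε : ℝ, (fun φ : ℝ => Real.cos (i * φ + ε)) ∈ trigPolyLE (N + 1) :=
      fun i hi ε => Submodule.subset_span ⟨i, hi, ε, rfl⟩
    rcases j with - | j
    · convert Submodule.smul_mem _ (Real.cos δ) (hmem 1 (by lia) (-(Real.pi / 2))) using 1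
      ext φ
      simp [← sub_eq_add_neg, Real.cos_sub_pi_div_two, mul_comm]
    · convert Submodule.smul_mem _ (1 / 2 : ℝ) (add_mem
        (hmem (j + 2) (by lia) (δ - Real.pi / 2)) (hmem j (by lia) (δ + Real.pi / 2))) using 1
      ext φ
      simp only [Pi.smul_apply, Pi.add_apply, smul_eq_mul]
      rw [← add_sub_assoc, ← add_assoc, Real.cos_sub_pi_div_two, Real.cos_add_pi_div_two]
      push_cast
      rw [show ((j : ℝ) + 2) * φ + δ = ((j + 1) * φ + δ) + φ by ring,
        show (j : ℝ) * φ + δ = ((j + 1) * φ + δ) - φ by ring, Real.sin_add, Real.sin_sub]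
      ring
  | zero => convert zero_mem (trigPolyLE (N + 1)) using 1; ext; simp
  | add f g _ _ hf hg => convert add_mem hf hg using 1; ext; simp [mul_add]
  | smul c f _ hf => convert Submodule.smul_mem _ c hf using 1; ext; simp [mul_left_comm]

lemma eval_sin_mem_trigPolyLE {N : ℕ} {p : Polynomial ℝ} (hp : p.natDegree ≤ N) :
    (fun φ => p.eval (Real.sin φ)) ∈ trigPolyLE N := by
  have hpow : ∀ m : ℕ, (fun φ => Real.sin φ ^ m) ∈ trigPolyLE m := by
    intro m
    induction m with
    | zero => exact Submodule.subset_span ⟨0, le_rfl, 0, by simp⟩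
    | succ m ih => simpa only [pow_succ'] using sin_mul_mem_trigPolyLE ih
  convert sum_mem (t := Finset.range (N + 1)) fun m hm => Submodule.smul_mem (trigPolyLE N)
    (p.coeff m) (trigPolyLE_mono (Nat.lt_succ_iff.1 (Finset.mem_range.1 hm)) (hpow m)) using 1
  ext φ
  simp [Polynomial.eval_eq_sum_range' (Nat.lt_succ_of_le hp)]

/-- **Bernstein's inequality** for algebraic polynomials. -/
lemma abs_derivative_eval_mul_sqrt_le {N : ℕ} (hN : N ≠ 0) {p : Polynomial ℝ}
    (hp : p.natDegree ≤ N) {a M : ℝ} (ha : 0 < a) (hM : ∀ s, |s| ≤ a → |p.eval s| ≤ M) {s : ℝ}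
    (hs : |s| ≤ a) : |p.derivative.eval s| * √(a ^ 2 - s ^ 2) ≤ N * M := by
  set q := p.comp (Polynomial.C a * Polynomial.X) with hq
  have hqdeg : q.natDegree ≤ N := by
    rw [hq, Polynomial.natDegree_comp, Polynomial.natDegree_C_mul_X _ ha.ne', mul_one]
    exact hp
  have hqM : ∀ φ, |q.eval (Real.sin φ)| ≤ M := by
    intro φ
    simp only [hq, Polynomial.eval_comp, Polynomial.eval_mul, Polynomial.eval_C, Polynomial.eval_X]
    apply hM
    rw [abs_mul, abs_of_pos ha]
    exact mul_le_of_le_one_right ha.le (Real.abs_sin_le_one φ)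
  have h := abs_deriv_le_of_mem_trigPolyLE hN (eval_sin_mem_trigPolyLE hqdeg) hqM
    (Real.arcsin (s / a))
  have hderiv : HasDerivAt (fun φ => q.eval (Real.sin φ))
      (q.derivative.eval (Real.sin (Real.arcsin (s / a))) * Real.cos (Real.arcsin (s / a))) _ :=
    (q.hasDerivAt _).comp _ (Real.hasDerivAt_sin _)
  rw [hderiv.deriv, Real.cos_arcsin,
    Real.sin_arcsin (by rw [le_div_iff₀ ha]; linarith [neg_le_of_abs_le hs])
      (by rw [div_le_one ha]; exact le_of_abs_le hs)] at h
  rw [abs_mul, abs_of_nonneg (Real.sqrt_nonneg _), hq, Polynomial.derivative_comp] at h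
  have hsqrt : √(a ^ 2 - s ^ 2) = a * √(1 - (s / a) ^ 2) := by
    rw [show a ^ 2 - s ^ 2 = a ^ 2 * (1 - (s / a) ^ 2) by field_simp, Real.sqrt_mul (sq_nonneg a),
      Real.sqrt_sq ha.le]
  simp only [Polynomial.derivative_C_mul, Polynomial.derivative_X, mul_one, Polynomial.eval_mul,
    Polynomial.eval_C, Polynomial.eval_comp, Polynomial.eval_X, mul_div_cancel₀ _ ha.ne', abs_mul,
    abs_of_pos ha] at h
  rw [hsqrt]
  linarith

lemma chebyshev_sub_eval_sin (k : ℕ) (x : ℝ) :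
    (Polynomial.Chebyshev.T ℝ (2 * k + 1) - Polynomial.Chebyshev.T ℝ (2 * k - 1)).eval
      (Real.sin x) = 2 * (-1) ^ k * (Real.sin (k * (2 * x)) * Real.cos x) := by
  rw [Polynomial.eval_sub, ← Real.cos_pi_div_two_sub x, Polynomial.Chebyshev.T_real_cos,
    Polynomial.Chebyshev.T_real_cos, Real.cos_sub_cos]
  push_cast
  rw [show ((2 * (k : ℝ) + 1) * (Real.pi / 2 - x) + (2 * k - 1) * (Real.pi / 2 - x)) / 2 =
      k * Real.pi - k * (2 * x) by ring,
    show ((2 * (k : ℝ) + 1) * (Real.pi / 2 - x) - (2 * k - 1) * (Real.pi / 2 - x)) / 2 =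
      Real.pi / 2 - x by ring, Real.sin_nat_mul_pi_sub, Real.sin_pi_div_two_sub]
  ring

/-- An odd trigonometric polynomial at `2 * x`, multiplied by `cos x`, is a polynomial in
`sin x`. -/
lemma exists_polynomial_eval_sin_eq (n : ℕ) (β : ℕ → ℝ) :
    ∃ p : Polynomial ℝ, p.natDegree ≤ 2 * n + 1 ∧ ∀ x, p.eval (Real.sin x) =
      (∑ k ∈ Finset.Icc 1 n, β k * Real.sin (k * (2 * x))) * Real.cos x := by
  refine ⟨∑ k ∈ Finset.Icc 1 n, Polynomial.C (β k * (-1) ^ k / 2) *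
    (Polynomial.Chebyshev.T ℝ (2 * k + 1) - Polynomial.Chebyshev.T ℝ (2 * k - 1)),
    Polynomial.natDegree_sum_le_of_forall_le _ _ fun k hk => ?_, fun x => ?_⟩
  · rw [Finset.mem_Icc] at hk
    refine (Polynomial.natDegree_C_mul_le _ _).trans ((Polynomial.natDegree_sub_le _ _).trans ?_)
    rw [Polynomial.Chebyshev.natDegree_T, Polynomial.Chebyshev.natDegree_T]
    lia
  · rw [Polynomial.eval_finsetSum, Finset.sum_mul]
    refine Finset.sum_congr rfl fun k _ => ?_
    rw [Polynomial.eval_mul, Polynomial.eval_C, chebyshev_sub_eval_sin]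
    have : ((-1 : ℝ) ^ k) * (-1) ^ k = 1 := by rw [← mul_pow]; simp
    linear_combination (β k * (Real.sin (k * (2 * x)) * Real.cos x)) * this

lemma le_mul_sqrt_sin_sq_sub {y x : ℝ} (hy : 0 < y) (hy' : y ≤ Real.pi / 4) (hx : |x| ≤ y) :
    y ≤ 7 / 5 * √(Real.sin (2 * y) ^ 2 - Real.sin x ^ 2) := by
  have hpi := Real.pi_lt_d2
  have hsin : y - y ^ 3 / 6 < Real.sin y := Real.sin_gt_sub_cube hy
  have hsin' : 5 / 7 * y ≤ Real.sin y := by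
    have : y ^ 2 ≤ 1 := by nlinarith
    nlinarith
  have hcos : 1 / 2 ≤ Real.cos y ^ 2 := by
    rw [Real.cos_sq]
    linarith [Real.cos_nonneg_of_mem_Icc (x := 2 * y) ⟨by linarith, by linarith⟩]
  have hle : Real.sin x ^ 2 ≤ Real.sin y ^ 2 := by
    rw [abs_le] at hx
    apply sq_le_sq'
    · rw [← Real.sin_neg]
      exact Real.sin_le_sin_of_le_of_le_pi_div_two (by linarith) (by linarith) hx.1
    · exact Real.sin_le_sin_of_le_of_le_pi_div_two (by linarith) (by linarith) hx.2
  have : 5 / 7 * y ≤ √(Real.sin (2 * y) ^ 2 - Real.sin x ^ 2) := by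
    apply Real.le_sqrt_of_sq_le
    rw [Real.sin_two_mul]
    nlinarith [pow_le_pow_left₀ (by positivity) hsin' 2, sq_nonneg (Real.sin y)]
  linarith

/-- **Lemma 3.1 (Privalov-type inequality).** For each `b ∈ (0, π)` and every odd trigonometric
polynomial `T` of degree at most `n`, `max_{|t| ≤ b/2} |T'(t)| ≤ (10 n / b) max_{|t| ≤ b} |T(t)|`. -/
theorem bernstein_odd_trig_on_interval (b : ℝ) (hb : b ∈ Set.Ioo 0 Real.pi)
    (n : ℕ) (hn : 1 ≤ n) (T : ℝ → ℝ) (β : ℕ → ℝ)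
    (hT : ∀ t : ℝ, T t = ∑ k ∈ Finset.Icc 1 n, β k * Real.sin (k * t)) :
    ∀ t : ℝ, |t| ≤ b / 2 →
      |deriv T t| ≤ 10 * n / b * sSup ((fun u => |T u|) '' Set.Icc (-b) b) := by
  intro t ht
  obtain ⟨hb0, hbpi⟩ := hb
  have hpi := Real.pi_lt_d2
  have hn' : (1 : ℝ) ≤ n := by exact_mod_cast hn
  have hTdiff : Differentiable ℝ T := by
    rw [funext hT]
    fun_prop
  set M := sSup ((fun u => |T u|) '' Set.Icc (-b) b)
  have hM : ∀ u, |u| ≤ b → |T u| ≤ M := fun u hu =>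
    le_csSup (isCompact_Icc.image hTdiff.continuous.abs).bddAbove ⟨u, abs_le.1 hu, rfl⟩
  have hM0 : 0 ≤ M := (abs_nonneg _).trans (hM 0 (by simpa using hb0.le))
  obtain ⟨p, hpdeg, hp⟩ := exists_polynomial_eval_sin_eq n β
  have hpT : ∀ x, p.eval (Real.sin x) = T (2 * x) * Real.cos x := fun x => by rw [hp, hT]
  set x := t / 2 with hx
  have htx : t = 2 * x := by rw [hx]; ring
  have hxb : |x| ≤ b / 4 := by rw [hx, abs_div, abs_two]; linarith
  have hxb' := abs_le.1 hxb
  have ha : 0 < Real.sin (b / 2) := Real.sin_pos_of_pos_of_lt_pi (by linarith) (by linarith)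
  have hpM : ∀ s, |s| ≤ Real.sin (b / 2) → |p.eval s| ≤ M := by
    intro s hs
    rw [abs_le] at hs
    have hs1 := Real.sin_le_one (b / 2)
    have harc : |Real.arcsin s| ≤ b / 2 := by
      rw [abs_le]
      constructor
      · rw [Real.le_arcsin_iff_sin_le' ⟨by linarith, by linarith⟩, Real.sin_neg]
        exact hs.1
      · rw [Real.arcsin_le_iff_le_sin' ⟨by linarith, by linarith⟩]
        exact hs.2
    rw [← Real.sin_arcsin (x := s) (by linarith [hs.1]) (by linarith [hs.2]), hpT, abs_mul]
    refine (mul_le_of_le_one_right (abs_nonneg _) (Real.abs_cos_le_one _)).trans (hM _ ?_)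
    rw [abs_mul, abs_two]
    linarith
  have hcos : 0 < Real.cos x := Real.cos_pos_of_mem_Ioo ⟨by linarith, by linarith⟩
  have hsincos : |Real.sin x| ≤ Real.cos x := by
    apply abs_le_of_sq_le_sq _ hcos.le
    have := Real.cos_nonneg_of_mem_Icc (x := 2 * x) ⟨by linarith, by linarith⟩
    rw [Real.cos_two_mul'] at this
    linarith
  have hsin : |Real.sin x| ≤ Real.sin (b / 2) := by
    rw [abs_le, ← Real.sin_neg]
    exact ⟨Real.sin_le_sin_of_le_of_le_pi_div_two (by linarith) (by linarith) (by linarith),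
      Real.sin_le_sin_of_le_of_le_pi_div_two (by linarith) (by linarith) (by linarith)⟩
  have hbern := abs_derivative_eval_mul_sqrt_le (by lia) hpdeg ha hpM hsin
  have hroot := le_mul_sqrt_sin_sq_sub (y := b / 4) (by linarith) (by linarith) hxb
  rw [show 2 * (b / 4) = b / 2 by ring] at hroot
  have hderiv : p.derivative.eval (Real.sin x) * Real.cos x =
      2 * deriv T t * Real.cos x - T t * Real.sin x := by
    have h1 : HasDerivAt (fun y => p.eval (Real.sin y))
        (p.derivative.eval (Real.sin x) * Real.cos x) x :=
      (p.hasDerivAt _).comp _ (Real.hasDerivAt_sin _)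
    have h2 : HasDerivAt (fun y => T (2 * y)) (deriv T (2 * x) * (2 * 1)) x :=
      (hTdiff _).hasDerivAt.comp x ((hasDerivAt_id x).const_mul 2)
    rw [funext hpT] at h1
    rw [h1.unique (h2.mul (Real.hasDerivAt_cos x)), htx]
    ring
  have hP : b * |p.derivative.eval (Real.sin x)| ≤ 28 / 5 * ((2 * n + 1) * M) := by
    push_cast at hbern
    nlinarith [mul_le_mul_of_nonneg_left hroot (abs_nonneg (p.derivative.eval (Real.sin x)))]
  have hmain : 2 * |deriv T t| ≤ |p.derivative.eval (Real.sin x)| + M := by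
    refine le_of_mul_le_mul_right ?_ hcos
    calc 2 * |deriv T t| * Real.cos x = |2 * deriv T t * Real.cos x| := by
          rw [abs_mul, abs_mul, abs_two, abs_of_pos hcos]
      _ = |p.derivative.eval (Real.sin x) * Real.cos x + T t * Real.sin x| := by
          rw [hderiv, sub_add_cancel]
      _ ≤ |p.derivative.eval (Real.sin x)| * Real.cos x + |T t| * |Real.sin x| := by
          rw [← abs_mul (T t)]
          nth_rewrite 2 [← abs_of_pos hcos]
          rw [← abs_mul]
          exact abs_add_le _ _
      _ ≤ |p.derivative.eval (Real.sin x)| * Real.cos x + M * Real.cos x := by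
          gcongr
          exact hM t (by linarith)
      _ = _ := by ring
  rw [div_mul_eq_mul_div, le_div_iff₀ hb0]
  have hnM : M ≤ n * M := le_mul_of_one_le_left hM0 hn'
  nlinarith [mul_le_mul_of_nonneg_left hmain hb0.le, mul_le_mul_of_nonneg_right hbpi.le hM0]
end
end
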